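/- arXiv:1503.05114 — 7 statements merged into one kernel-verified Lean document; each statement's English description precedes it below -/
import Mathlib

section
/- Let k be a field of characteristic p (p prime; the identity in fact holds over any commutative ring) and fix N ∈ ℕ. In k[x_0,…,x_{N−1}] one has, for every j ∈ ℕ, ∂(e_j) = e_1·e_j − (j+1)·e_{j+1}, where the coefficient (j+1) denotes the image of the natural number j+1 in k. In particular ∂(e_N) = e_1·e_N, since e_{N+1} = 0. -/
open MvPolynomial

/-- If a derivation squares each `f i`, it multiplies a product of the `f i` by their sum. -/
theorem Derivation.apply_prod_of_apply_eq_sq {R A σ : Type*} [CommRing R] [CommRing A] [Algebra R A]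
    (D : Derivation R A A) (f : σ → A) (hD : ∀ i, D (f i) = f i ^ 2) (s : Finset σ) :
    D (∏ i ∈ s, f i) = (∑ i ∈ s, f i) * ∏ i ∈ s, f i := by
  classical
  induction s using Finset.induction_on with
  | empty => simp
  | insert a s ha ih =>
    rw [Finset.prod_insert ha, Finset.sum_insert ha, D.leibniz, ih, hD, smul_eq_mul, smul_eq_mul]
    ring

/-- Each squarefree monomial of degree `n + 1` arises in `n + 1` ways from one of degree `n` by
multiplication with a new variable. -/
theorem MvPolynomial.sum_compl_mul_prod_eq_mul_esymm {σ R : Type*} [Fintype σ] [DecidableEq σ]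
    [CommRing R] (n : ℕ) :
    ∑ t ∈ Finset.powersetCard n (Finset.univ : Finset σ),
        (∑ i ∈ tᶜ, (X i : MvPolynomial σ R)) * ∏ i ∈ t, X i =
      ((n + 1 : ℕ) : MvPolynomial σ R) * esymm σ R (n + 1) := by
  have hcard : ((n + 1 : ℕ) : MvPolynomial σ R) * esymm σ R (n + 1) =
      ∑ u ∈ Finset.powersetCard (n + 1) (Finset.univ : Finset σ), ∑ _i ∈ u, ∏ l ∈ u, X l := by
    rw [esymm, Finset.mul_sum]
    refine Finset.sum_congr rfl fun u hu => ?_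
    rw [Finset.sum_const, (Finset.mem_powersetCard.1 hu).2, nsmul_eq_mul]
  simp_rw [hcard, Finset.sum_mul, Finset.sum_sigma']
  refine Finset.sum_bij' (fun z _ => ⟨insert z.2 z.1, z.2⟩) (fun z _ => ⟨z.1.erase z.2, z.2⟩)
    ?_ ?_ ?_ ?_ ?_
  · rintro ⟨t, i⟩ h
    simp only [Finset.mem_sigma, Finset.mem_powersetCard_univ, Finset.mem_compl] at h ⊢
    simp [h.1, h.2]
  · rintro ⟨u, i⟩ h
    simp only [Finset.mem_sigma, Finset.mem_powersetCard_univ, Finset.mem_compl] at h ⊢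
    simp [h.1, h.2]
  · rintro ⟨t, i⟩ h
    simp only [Finset.mem_sigma, Finset.mem_compl] at h
    simp [h.2]
  · rintro ⟨u, i⟩ h
    simp only [Finset.mem_sigma] at h
    simp [h.2]
  · rintro ⟨t, i⟩ h
    simp only [Finset.mem_sigma, Finset.mem_compl] at h
    simp [h.2]

/-- In `k[x_0, …, x_{N-1}]` with the derivation `∂(x_i) = x_i^2`, one has
`∂(e_j) = e_1 · e_j - (j+1) · e_{j+1}` for every `j : ℕ`. -/
theorem stmt0 (p : ℕ) (hp : p.Prime) (k : Type*) [Field k] [CharP k p] (N : ℕ)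
    (D : Derivation k (MvPolynomial (Fin N) k) (MvPolynomial (Fin N) k))
    (hD : ∀ i, D (X i) = X i ^ 2) (j : ℕ) :
    D (esymm (Fin N) k j) =
      esymm (Fin N) k 1 * esymm (Fin N) k j
        - ((j + 1 : ℕ) : MvPolynomial (Fin N) k) * esymm (Fin N) k (j + 1) := by
  rw [← sum_compl_mul_prod_eq_mul_esymm, esymm_one, esymm, map_sum, Finset.mul_sum,
    ← Finset.sum_sub_distrib]
  refine Finset.sum_congr rfl fun t _ => ?_
  rw [D.apply_prod_of_apply_eq_sq X hD, ← Finset.sum_add_sum_compl t]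
  ring
end

section
/- Let k be a field of characteristic p (p prime; the identity in fact holds over any commutative ring) and fix N ∈ ℕ. In k[x_0,…,x_{N−1}] one has, for every j ∈ ℕ, ∂(h_j) = (j+1)·h_{j+1} − h_1·h_j, where h_j is the j-th complete homogeneous symmetric polynomial in the N variables (the sum of all monomials of total degree j) and the coefficient (j+1) denotes the image of the natural number j+1 in k. -/
open MvPolynomial

/-- Summing over `i ::ₛ s` for all `s` amounts to summing over all `t`, if the summand vanishes
whenever `i ∉ t`. -/
theorem Sym.sum_cons_eq_sum {σ M : Type*} [Fintype σ] [DecidableEq σ] [AddCommMonoid M] {n : ℕ}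
    (i : σ) (f : Sym σ (n + 1) → M) (hf : ∀ t, i ∉ t → f t = 0) :
    ∑ s : Sym σ n, f (i ::ₛ s) = ∑ t, f t := by
  refine Finset.sum_of_injOn (fun s => i ::ₛ s) (fun s _ t _ h => Sym.cons_inj_right i s t |>.1 h)
    (fun _ _ => Finset.mem_coe.2 (Finset.mem_univ _)) (fun t _ ht => hf t fun hi => ht ?_)
    (fun _ _ => rfl)
  obtain ⟨s, rfl⟩ := Sym.exists_cons_of_mem hi
  exact ⟨s, by simp, rfl⟩

namespace MvPolynomial

variable {σ R : Type*} [Fintype σ] [DecidableEq σ] [CommRing R]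

theorem derivation_prod_map_X_of_sq (D : Derivation R (MvPolynomial σ R) (MvPolynomial σ R))
    (hD : ∀ i, D (X i) = X i ^ 2) (s : Multiset σ) :
    D (s.map X).prod = ∑ i, (s.count i : MvPolynomial σ R) * (X i * (s.map X).prod) := by
  induction s using Multiset.induction_on with
  | empty => simp
  | cons a s ih =>
    simp only [Multiset.map_cons, Multiset.prod_cons, Derivation.leibniz, hD, ih, smul_eq_mul,
      Multiset.count_cons, Nat.cast_add, add_mul, Finset.sum_add_distrib, Finset.mul_sum]
    refine congrArg₂ (· + ·) (Finset.sum_congr rfl fun i _ => by ring) ?_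
    simp only [Nat.cast_ite, Nat.cast_one, Nat.cast_zero, ite_mul, one_mul, zero_mul,
      Finset.sum_ite_eq', Finset.mem_univ, if_true]
    ring

theorem derivation_hsymm_of_sq (D : Derivation R (MvPolynomial σ R) (MvPolynomial σ R))
    (hD : ∀ i, D (X i) = X i ^ 2) (n : ℕ) :
    D (hsymm σ R n) =
      ((n + 1 : ℕ) : MvPolynomial σ R) * hsymm σ R (n + 1) - hsymm σ R 1 * hsymm σ R n := by
  rw [eq_sub_iff_add_eq, hsymm_one]
  calc D (hsymm σ R n) + (∑ i, X i) * hsymm σ R n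
      = ∑ i, ∑ s : Sym σ n, (((i ::ₛ s).1.count i : ℕ) : MvPolynomial σ R) *
          ((i ::ₛ s).1.map X).prod := by
        simp only [hsymm, map_sum, derivation_prod_map_X_of_sq D hD, Finset.sum_mul_sum]
        rw [Finset.sum_comm, ← Finset.sum_add_distrib]
        refine Finset.sum_congr rfl fun i _ => ?_
        rw [← Finset.sum_add_distrib]
        refine Finset.sum_congr rfl fun s _ => ?_
        change _ = (((i ::ₘ s.1).count i : ℕ) : MvPolynomial σ R) * ((i ::ₘ s.1).map X).prod
        simp only [Multiset.count_cons_self, Multiset.map_cons, Multiset.prod_cons]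
        push_cast
        ring
    _ = ∑ i, ∑ t : Sym σ (n + 1), ((t.1.count i : ℕ) : MvPolynomial σ R) * (t.1.map X).prod := by
        refine Finset.sum_congr rfl fun i _ => Sym.sum_cons_eq_sum i
          (fun t => ((t.1.count i : ℕ) : MvPolynomial σ R) * (t.1.map X).prod) fun t ht => ?_
        have h : t.1.count i = 0 := Multiset.count_eq_zero.2 ht
        change ((t.1.count i : ℕ) : MvPolynomial σ R) * _ = 0
        rw [h, Nat.cast_zero, zero_mul]
    _ = ((n + 1 : ℕ) : MvPolynomial σ R) * hsymm σ R (n + 1) := by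
        rw [Finset.sum_comm, hsymm, Finset.mul_sum]
        refine Finset.sum_congr rfl fun t _ => ?_
        rw [← Finset.sum_mul, ← Nat.cast_sum,
          Multiset.sum_count_eq_card fun a _ => Finset.mem_univ a, t.2]

end MvPolynomial

/-- In `k[x_0, …, x_{N-1}]` with the derivation `∂(x_i) = x_i^2`, one has
`∂(h_j) = (j+1) · h_{j+1} - h_1 · h_j` for every `j : ℕ`, where `h_j` is the
`j`-th complete homogeneous symmetric polynomial. -/
theorem stmt1 (p : ℕ) (hp : p.Prime) (k : Type*) [Field k] [CharP k p] (N : ℕ)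
    (D : Derivation k (MvPolynomial (Fin N) k) (MvPolynomial (Fin N) k))
    (hD : ∀ i, D (X i) = X i ^ 2) (j : ℕ) :
    D (hsymm (Fin N) k j) =
      ((j + 1 : ℕ) : MvPolynomial (Fin N) k) * hsymm (Fin N) k (j + 1)
        - hsymm (Fin N) k 1 * hsymm (Fin N) k j :=
  derivation_hsymm_of_sq D hD j
end

section
/- Let k be a field of characteristic p (p prime) and 1 ≤ n < p. Let I ⊂ Sym_n be the augmentation ideal, i.e., the set of symmetric polynomials in k[x_0,…,x_{n−1}] with zero constant coefficient (a ∂-stable subspace, since ∂ raises degree). Then the p-complex (I, ∂) is acyclic: for every s with 1 ≤ s ≤ p−1, {f ∈ I : ∂^s f = 0} = ∂^{p−s}(I). (Equivalently, the p-DG algebra Sym_n is quasi-isomorphic to k.) -/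
open MvPolynomial

/-- The general Leibniz rule for the iterates of a derivation. -/
theorem Derivation.iterate_apply_mul {R A : Type*} [CommSemiring R] [CommSemiring A] [Algebra R A]
    (D : Derivation R A A) (m : ℕ) (a b : A) :
    D^[m] (a * b) =
      ∑ ij ∈ Finset.HasAntidiagonal.antidiagonal m, m.choose ij.1 • (D^[ij.1] a * D^[ij.2] b) := by
  induction m with
  | zero => simp
  | succ m ih =>
    rw [Finset.sum_antidiagonal_choose_succ_nsmul (M := A) (fun i j => D^[i] a * D^[j] b) m]
    simp only [Function.iterate_succ_apply', ih, map_sum, map_nsmul, Derivation.leibniz, smul_add,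
      Finset.sum_add_distrib, smul_eq_mul]
    congr 1
    refine Finset.sum_congr rfl fun ⟨i, j⟩ hij ↦ ?_
    rw [m.choose_symm_of_eq_add (Finset.HasAntidiagonal.mem_antidiagonal.1 hij).symm,
      mul_comm (D^[j] b)]

/-- In characteristic `p`, the `p`-th iterate of a derivation satisfies the Leibniz rule. -/
theorem Derivation.iterate_char_apply_mul {R A : Type*} [CommSemiring R] [CommRing A] [Algebra R A]
    (p : ℕ) (hp : p.Prime) [CharP A p] (D : Derivation R A A) (a b : A) :
    D^[p] (a * b) = a * D^[p] b + D^[p] a * b := by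
  rw [D.iterate_apply_mul,
    Finset.Nat.sum_antidiagonal_eq_sum_range_succ (fun i j ↦ p.choose i • (D^[i] a * D^[j] b)),
    Finset.sum_range_succ, ← Finset.sum_erase_add _ _ (Finset.mem_range.2 hp.pos),
    Finset.sum_eq_zero]
  · simp
  · intro i hi
    simp only [Finset.mem_erase, Finset.mem_range] at hi
    rw [nsmul_eq_mul, (CharP.cast_eq_zero_iff A p _).2 (hp.dvd_choose_self hi.1 hi.2), zero_mul]

section Weyl

variable {k V : Type*} [Field k] [AddCommGroup V] [Module k V] {S : Submodule k V}
  {D h : V →ₗ[k] V}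

theorem apply_iterate_of_weyl_relation (hh : ∀ v ∈ S, h v ∈ S)
    (hDh : ∀ v ∈ S, D (h v) = h (D v) + v) {v : V} (hv : v ∈ S) (hv0 : D v = 0) (j : ℕ) :
    D (h^[j + 1] v) = ((j + 1 : ℕ) : k) • h^[j] v := by
  have hmem (j : ℕ) : h^[j] v ∈ S := Set.MapsTo.iterate (s := (S : Set V)) hh j hv
  induction j with
  | zero => simp [hDh v hv, hv0]
  | succ j ih =>
    rw [Function.iterate_succ_apply', hDh _ (hmem _), ih, map_smul,
      ← Function.iterate_succ_apply' h]
    push_cast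
    module

theorem iterate_iterate_of_weyl_relation (hh : ∀ v ∈ S, h v ∈ S)
    (hDh : ∀ v ∈ S, D (h v) = h (D v) + v) {v : V} (hv : v ∈ S) (hv0 : D v = 0) (j : ℕ) :
    D^[j] (h^[j] v) = (j.factorial : k) • v := by
  induction j with
  | zero => simp
  | succ j ih =>
    rw [Function.iterate_succ_apply, apply_iterate_of_weyl_relation hh hDh hv hv0,
      ← Module.End.coe_pow, map_smul, Module.End.coe_pow, ih, smul_smul, Nat.factorial_succ,
      Nat.cast_mul]

/-- If `D h - h D = 1` on `S` in characteristic `p`, then the kernel of `D ^ s` on `S` is contained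
in the image of `D ^ (p - s)`. -/
theorem exists_iterate_eq_of_weyl_relation {p : ℕ} (hp : p.Prime) [CharP k p]
    (hD : ∀ v ∈ S, D v ∈ S) (hh : ∀ v ∈ S, h v ∈ S) (hDh : ∀ v ∈ S, D (h v) = h (D v) + v)
    {s : ℕ} (hs : s < p) {v : V} (hv : v ∈ S) (hsv : D^[s] v = 0) :
    ∃ w ∈ S, D^[p - s] w = v := by
  have hDmem (j : ℕ) {w : V} (hw : w ∈ S) : D^[j] w ∈ S :=
    Set.MapsTo.iterate (s := (S : Set V)) hD j hw
  have hker {u : V} (hu : u ∈ S) (hu0 : D u = 0) : ∃ w ∈ S, D^[p - 1] w = u := by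
    have hfac : ((p - 1).factorial : k) ≠ 0 := by
      rw [Ne, CharP.cast_eq_zero_iff k p, hp.dvd_factorial]
      have := hp.pos
      omega
    refine ⟨((p - 1).factorial : k)⁻¹ • h^[p - 1] u,
      S.smul_mem _ (Set.MapsTo.iterate (s := (S : Set V)) hh _ hu), ?_⟩
    rw [← Module.End.coe_pow D, map_smul, Module.End.coe_pow,
      iterate_iterate_of_weyl_relation hh hDh hu hu0, smul_smul, inv_mul_cancel₀ hfac, one_smul]
  induction s generalizing v with
  | zero => exact ⟨0, S.zero_mem, by rw [← Module.End.coe_pow, map_zero]; exact hsv.symm⟩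
  | succ s ih =>
    obtain ⟨g, hg, hgv⟩ := ih (by omega) (hD v hv) hsv
    have hps : p - s = (p - (s + 1)) + 1 := by omega
    obtain ⟨w, hw, hwv⟩ := hker (u := v - D^[p - (s + 1)] g) (S.sub_mem hv (hDmem _ hg)) (by
      rw [map_sub, ← Function.iterate_succ_apply' D, Nat.succ_eq_add_one, ← hps, hgv, sub_self])
    refine ⟨g + D^[s] w, S.add_mem hg (hDmem _ hw), ?_⟩
    rw [← Module.End.coe_pow D (p - (s + 1)), map_add, Module.End.coe_pow,
      ← Function.iterate_add_apply, show p - (s + 1) + s = p - 1 by omega, hwv]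
    abel

end Weyl

namespace MvPolynomial

variable {k σ : Type*} [Field k] {D : Derivation k (MvPolynomial σ k) (MvPolynomial σ k)}

theorem derivation_monomial_of_X_sq [Fintype σ] (hD : ∀ i, D (X i) = X i ^ 2) (a : σ →₀ ℕ) :
    D (monomial a 1) = ∑ i, (a i : k) • monomial (a + Finsupp.single i 1) 1 := by
  have hDeq : D = mkDerivation k fun i ↦ X i ^ 2 := derivation_ext fun i ↦ by simp [hD]
  rw [hDeq, mkDerivation_monomial, one_smul, Finsupp.sum_fintype _ _ (by simp)]
  refine Finset.sum_congr rfl fun i _ ↦ ?_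
  rcases Nat.eq_zero_or_pos (a i) with hi | hi
  · simp [hi]
  · rw [X_pow_eq_monomial, smul_eq_mul, monomial_mul, smul_monomial, smul_eq_mul, mul_one]
    congr 2
    ext j
    rcases eq_or_ne i j with rfl | hij
    · simp
      omega
    · simp [hij]

theorem iterate_derivation_X (hD : ∀ i, D (X i) = X i ^ 2) (i : σ) (m : ℕ) :
    D^[m] (X i) = (m.factorial : MvPolynomial σ k) * X i ^ (m + 1) := by
  induction m with
  | zero => simp
  | succ m ih =>
    rw [Function.iterate_succ_apply', ih, Derivation.leibniz, Derivation.map_natCast,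
      Derivation.leibniz_pow, hD, Nat.factorial_succ]
    simp only [smul_eq_mul, nsmul_eq_mul, Nat.add_sub_cancel]
    push_cast
    ring

theorem iterate_derivation_char_eq_zero (p : ℕ) (hp : p.Prime) [CharP k p]
    (hD : ∀ i, D (X i) = X i ^ 2) (f : MvPolynomial σ k) : D^[p] f = 0 := by
  induction f using MvPolynomial.induction_on with
  | C a =>
    obtain ⟨m, rfl⟩ := Nat.exists_eq_succ_of_ne_zero hp.ne_zero
    rw [Function.iterate_succ_apply, derivation_C]
    exact iterate_map_zero D m
  | add f g hf hg => rw [iterate_map_add, hf, hg, add_zero]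
  | mul_X f i hf =>
    rw [D.iterate_char_apply_mul p hp, hf, iterate_derivation_X hD,
      (CharP.cast_eq_zero_iff (MvPolynomial σ k) p _).2 (hp.dvd_factorial.2 le_rfl)]
    simp

theorem rename_derivation_of_X_sq (hD : ∀ i, D (X i) = X i ^ 2) (e : Equiv.Perm σ)
    (f : MvPolynomial σ k) : rename e (D f) = D (rename e f) := by
  induction f using MvPolynomial.induction_on with
  | C a => simp
  | add f g hf hg => simp [hf, hg]
  | mul_X f i hf => simp [hf, hD]

theorem constantCoeff_derivation_of_X_sq (hD : ∀ i, D (X i) = X i ^ 2) (f : MvPolynomial σ k) :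
    constantCoeff (D f) = 0 := by
  induction f using MvPolynomial.induction_on with
  | C a => simp
  | add f g hf hg => simp [hf, hg]
  | mul_X f i hf => simp [hf, hD]

variable [Fintype σ]

variable (k σ) in
/-- The operator lowering by one, in all possible ways, an exponent which is at least `2`,
normalized by minus the number of variables occurring in the monomial. -/
noncomputable def lowering : MvPolynomial σ k →ₗ[k] MvPolynomial σ k :=
  (basisMonomials σ k).constr k fun a ↦
    (-(a.support.card : k)⁻¹) •
      ∑ i, if 2 ≤ a i then monomial (a - Finsupp.single i 1) (1 : k) else 0

theorem lowering_monomial (a : σ →₀ ℕ) :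
    lowering k σ (monomial a 1) = (-(a.support.card : k)⁻¹) •
      ∑ i, if 2 ≤ a i then monomial (a - Finsupp.single i 1) (1 : k) else 0 := by
  have := (basisMonomials σ k).constr_basis k (fun a : σ →₀ ℕ ↦
    (-(a.support.card : k)⁻¹) •
      ∑ i, if 2 ≤ a i then monomial (a - Finsupp.single i 1) (1 : k) else 0) a
  rw [coe_basisMonomials] at this
  rw [← this, lowering]

theorem rename_lowering (e : Equiv.Perm σ) (f : MvPolynomial σ k) :
    rename e (lowering k σ f) = lowering k σ (rename e f) := by
  suffices h : (rename e).toLinearMap ∘ₗ lowering k σ = lowering k σ ∘ₗ (rename e).toLinearMap from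
    LinearMap.congr_fun h f
  refine (basisMonomials σ k).ext fun a ↦ ?_
  have hcard : (a.mapDomain e).support.card = a.support.card := by
    classical
    rw [Finsupp.mapDomain_support_of_injective e.injective,
      Finset.card_image_of_injective _ e.injective]
  simp only [coe_basisMonomials, LinearMap.comp_apply, AlgHom.toLinearMap_apply, rename_monomial,
    lowering_monomial, map_smul, map_sum, hcard]
  congr 1
  refine Fintype.sum_equiv e _ _ fun i ↦ ?_
  rw [Finsupp.mapDomain_apply e.injective]
  split_ifs
  · rw [rename_monomial]
    congr 2
    ext j
    obtain ⟨j, rfl⟩ := e.surjective j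
    rw [Finsupp.mapDomain_apply e.injective, Finsupp.tsub_apply, Finsupp.tsub_apply,
      Finsupp.mapDomain_apply e.injective, ← Finsupp.mapDomain_single,
      Finsupp.mapDomain_apply e.injective]
  · simp

theorem constantCoeff_lowering (f : MvPolynomial σ k) : constantCoeff (lowering k σ f) = 0 := by
  suffices h : lcoeff k (0 : σ →₀ ℕ) ∘ₗ lowering k σ = 0 from LinearMap.congr_fun h f
  refine (basisMonomials σ k).ext fun a ↦ ?_
  simp only [coe_basisMonomials, LinearMap.comp_apply, lowering_monomial, map_smul, map_sum,
    LinearMap.zero_apply]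
  rw [Finset.sum_eq_zero, smul_zero]
  intro i _
  split_ifs with hi
  · classical
    rw [lcoeff_apply, coeff_monomial, if_neg]
    intro h
    have := DFunLike.congr_fun h i
    simp at this
    omega
  · simp

/-- The commutator of the derivation with the lowering operator is
the projection onto the polynomials without constant term. -/
theorem derivation_lowering {p : ℕ} [CharP k p] (hσ : Fintype.card σ < p)
    (hD : ∀ i, D (X i) = X i ^ 2) (f : MvPolynomial σ k) :
    D (lowering k σ f) = lowering k σ (D f) + (f - C (constantCoeff f)) := by
  classical
  suffices h : D.toLinearMap ∘ₗ lowering k σ = lowering k σ ∘ₗ D.toLinearMap +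
      (LinearMap.id - Algebra.linearMap k (MvPolynomial σ k) ∘ₗ lcoeff k 0) from
    LinearMap.congr_fun h f
  refine (basisMonomials σ k).ext fun a ↦ ?_
  set c : k := -(a.support.card : k)⁻¹ with hc
  have hlow (j : σ) : (a j : k) • lowering k σ (monomial (a + Finsupp.single j 1) 1) =
      c • ∑ i, (a j : k) • if 2 ≤ (a + Finsupp.single j 1 : σ →₀ ℕ) i then
        monomial (a + Finsupp.single j 1 - Finsupp.single i 1) (1 : k) else 0 := by
    rcases eq_or_ne (a j) 0 with hj | hj
    · simp [hj]
    · have hsupp : (a + Finsupp.single j 1).support = a.support := by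
        ext l
        rcases eq_or_ne j l with rfl | hl
        · simp [hj]
        · simp [hl]
      rw [lowering_monomial, hsupp, ← hc, smul_comm, Finset.smul_sum]
  have hterm (i j : σ) :
      (if 2 ≤ a i then ((a - Finsupp.single i 1 : σ →₀ ℕ) j : k) •
          monomial (a - Finsupp.single i 1 + Finsupp.single j 1) (1 : k) else 0) =
        ((a j : k) • if 2 ≤ (a + Finsupp.single j 1 : σ →₀ ℕ) i then
          monomial (a + Finsupp.single j 1 - Finsupp.single i 1) (1 : k) else 0) -
        if j = i then (if i ∈ a.support then monomial a (1 : k) else 0) else 0 := by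
    rcases eq_or_ne j i with rfl | hij
    · have hone : a + Finsupp.single j 1 - Finsupp.single j 1 = a := by simp
      simp only [hone, Finsupp.add_apply, Finsupp.single_eq_same, Finsupp.tsub_apply, if_true,
        Finsupp.mem_support_iff]
      rcases Nat.lt_or_ge (a j) 2 with hj | hj
      · interval_cases a j <;> simp
      · have hcancel : a - Finsupp.single j 1 + Finsupp.single j 1 = a :=
          tsub_add_cancel_of_le (by rw [Finsupp.single_le_iff]; omega)
        rw [hcancel, if_pos hj, if_pos (by omega), if_pos (by omega), Nat.cast_sub (by omega)]
        module
    · have hne : a - Finsupp.single i 1 + Finsupp.single j 1 =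
          a + Finsupp.single j 1 - Finsupp.single i 1 := by
        ext l
        rcases eq_or_ne l i with rfl | hl
        · simp [hij]
        · simp [hl]
      simp only [Finsupp.add_apply, Finsupp.tsub_apply, Finsupp.single_eq_of_ne hij,
        Finsupp.single_eq_of_ne hij.symm, hne, if_neg hij, add_zero, tsub_zero, sub_zero]
      split_ifs <;> simp
  have hDlow : D (lowering k σ (monomial a 1)) =
      lowering k σ (D (monomial a 1)) - c • (a.support.card : k) • monomial a 1 := by
    have hcard : ((a.support.card : k) • monomial a 1 : MvPolynomial σ k) =
        ∑ i, ∑ j, if j = i then (if i ∈ a.support then monomial a (1 : k) else 0) else 0 := by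
      simp only [Finset.sum_ite_eq', Finset.mem_univ, if_true, Finset.sum_ite_mem,
        Finset.univ_inter, Finset.sum_const, Nat.cast_smul_eq_nsmul]
    have hDterm (i : σ) : D (if 2 ≤ a i then monomial (a - Finsupp.single i 1) (1 : k) else 0) =
        ∑ j, if 2 ≤ a i then ((a - Finsupp.single i 1 : σ →₀ ℕ) j : k) •
          monomial (a - Finsupp.single i 1 + Finsupp.single j 1) (1 : k) else 0 := by
      split_ifs
      · rw [derivation_monomial_of_X_sq hD]
      · simp
    rw [lowering_monomial, ← hc, Derivation.map_smul, map_sum, derivation_monomial_of_X_sq hD,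
      map_sum, hcard]
    simp only [map_smul, hlow, hDterm, hterm, Finset.sum_sub_distrib]
    rw [← Finset.smul_sum, ← smul_sub, Finset.sum_comm]
  simp only [coe_basisMonomials, LinearMap.comp_apply, LinearMap.add_apply, LinearMap.sub_apply,
    LinearMap.id_apply, Derivation.coeFn_coe, hDlow]
  rw [sub_eq_add_neg]
  congr 1
  rcases eq_or_ne a 0 with rfl | ha
  · simp
  · have hcard : (a.support.card : k) ≠ 0 := by
      rw [Ne, CharP.cast_eq_zero_iff k p]
      refine Nat.not_dvd_of_pos_of_lt ?_ (a.support.card_le_univ.trans_lt hσ)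
      rwa [Finset.card_pos, Finsupp.support_nonempty_iff]
    rw [smul_smul, hc, neg_mul, inv_mul_cancel₀ hcard, lcoeff_apply, coeff_monomial, if_neg ha]
    simp

end MvPolynomial

/-- For `1 ≤ n < p`, the augmentation ideal of the algebra of symmetric polynomials
(symmetric polynomials with zero constant term), as a `p`-complex under `∂`, is acyclic:
for all `1 ≤ s ≤ p-1`, the kernel of `∂^s` on the ideal equals the image of `∂^{p-s}`. -/
theorem stmt3 (p : ℕ) (hp : p.Prime) (k : Type*) [Field k] [CharP k p]
    (n : ℕ) (hn1 : 1 ≤ n) (hnp : n < p)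
    (D : Derivation k (MvPolynomial (Fin n) k) (MvPolynomial (Fin n) k))
    (hD : ∀ i, D (X i) = X i ^ 2)
    (I : Set (MvPolynomial (Fin n) k))
    (hI : I = {f | f.IsSymmetric ∧ constantCoeff f = 0}) :
    ∀ s : ℕ, 1 ≤ s → s ≤ p - 1 →
      {f | f ∈ I ∧ (⇑D)^[s] f = 0} = (⇑D)^[p - s] '' I := by
  intro s hs hsp
  let S : Submodule k (MvPolynomial (Fin n) k) :=
    (symmetricSubalgebra (Fin n) k).toSubmodule ⊓ LinearMap.ker (lcoeff k (0 : Fin n →₀ ℕ))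
  have hS : I = S := hI
  have hDS : ∀ f ∈ S, D f ∈ S := fun f hf ↦
    ⟨fun e ↦ by rw [rename_derivation_of_X_sq hD, hf.1 e], constantCoeff_derivation_of_X_sq hD f⟩
  have hlS : ∀ f ∈ S, lowering k (Fin n) f ∈ S := fun f hf ↦
    ⟨fun e ↦ by rw [rename_lowering, hf.1 e], constantCoeff_lowering f⟩
  have hcomm : ∀ f ∈ S, D (lowering k (Fin n) f) = lowering k (Fin n) (D f) + f := fun f hf ↦ by
    have hf0 : constantCoeff f = 0 := hf.2
    rw [derivation_lowering (p := p) (by simpa using hnp) hD, hf0, map_zero, sub_zero]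
  rw [hS]
  apply Set.Subset.antisymm
  · rintro f ⟨hf, hsf⟩
    exact exists_iterate_eq_of_weyl_relation (D := D.toLinearMap) hp hDS hlS hcomm
      (by have := hp.pos; omega) hf hsf
  · rintro _ ⟨g, hg, rfl⟩
    refine ⟨Set.MapsTo.iterate (s := (S : Set (MvPolynomial (Fin n) k))) hDS _ hg, ?_⟩
    rw [← Function.iterate_add_apply, show s + (p - s) = p by omega,
      iterate_derivation_char_eq_zero p hp hD]
end

section
/- Let k be a field of characteristic p (p prime) and suppose 1 ≤ a ≤ n < p. Let J = e_n^a·Sym_n be the ideal of the algebra Sym_n of symmetric polynomials in k[x_0,…,x_{n−1}] generated by e_n^a (a ∂-stable subspace, since ∂(e_n^a) = a·e_1·e_n^a). Then the p-complex (J, ∂) is acyclic: for every s with 1 ≤ s ≤ p−1, {f ∈ J : ∂^s f = 0} = ∂^{p−s}(J). -/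
open MvPolynomial

/-- The kernel of `f ^ s` on `S` is contained in the image of `f ^ (p - s)` on `S`, for all
`1 ≤ s < p`. -/
def KernelsLiftable {k V : Type*} [Field k] [AddCommGroup V] [Module k V] (p : ℕ)
    (f : Module.End k V) (S : Submodule k V) : Prop :=
  ∀ s, 1 ≤ s → s < p → ∀ v ∈ S, (f ^ s) v = 0 → ∃ w ∈ S, (f ^ (p - s)) w = v

section LinearAlgebra

variable {k V W : Type*} [Field k] [AddCommGroup V] [Module k V] [AddCommGroup W] [Module k W]

theorem pow_apply_mem {f : Module.End k V} {S : Submodule k V} (hf : ∀ v ∈ S, f v ∈ S) (m : ℕ) :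
    ∀ v ∈ S, (f ^ m) v ∈ S := by
  induction m with
  | zero => simp
  | succ m ih => intro v hv; rw [pow_succ]; exact ih _ (hf v hv)

theorem pow_apply_intertwine {f : Module.End k V} {g : Module.End k W} {φ : V →ₗ[k] W}
    (h : ∀ v, φ (f v) = g (φ v)) (m : ℕ) (v : V) : φ ((f ^ m) v) = (g ^ m) (φ v) := by
  induction m generalizing v with
  | zero => simp
  | succ m ih => rw [pow_succ, pow_succ, Module.End.mul_apply, ih, h, Module.End.mul_apply]

/-- If `f` and `E` satisfy a Weyl relation `f E = E f + c` with `c ≠ 0`, then the kernels of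
the powers of `f` on `S` are as small as possible. -/
theorem KernelsLiftable.of_weyl {p : ℕ} (hp : p.Prime) [CharP k p] {f E : Module.End k V}
    {S : Submodule k V} (hf : ∀ v ∈ S, f v ∈ S) (hE : ∀ v ∈ S, E v ∈ S) {c : k} (hc : c ≠ 0)
    (h : ∀ v, f (E v) = E (f v) + c • v) : KernelsLiftable p f S := by
  have hfE (m : ℕ) (v : V) (hv : f v = 0) :
      f ((E ^ (m + 1)) v) = (((m + 1 : ℕ) : k) * c) • (E ^ m) v := by
    induction m with
    | zero => simp [h, hv]
    | succ m ih =>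
      rw [pow_succ' E (m + 1), Module.End.mul_apply, h, ih, map_smul, ← Module.End.mul_apply,
        ← pow_succ', ← add_smul]
      congr 1
      push_cast
      ring
  have hff (m : ℕ) (v : V) (hv : f v = 0) :
      (f ^ m) ((E ^ m) v) = ((m.factorial : k) * c ^ m) • v := by
    induction m with
    | zero => simp
    | succ m ih =>
      rw [pow_succ f, Module.End.mul_apply, hfE m v hv, map_smul, ih, smul_smul]
      congr 1
      rw [Nat.factorial_succ]
      push_cast
      ring
  have hone (v : V) (hv : v ∈ S) (hfv : f v = 0) : ∃ w ∈ S, (f ^ (p - 1)) w = v := by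
    have hu : ((p - 1).factorial : k) * c ^ (p - 1) ≠ 0 := by
      refine mul_ne_zero ?_ (pow_ne_zero _ hc)
      rw [Ne, CharP.cast_eq_zero_iff k p, hp.dvd_factorial]
      have := hp.pos
      omega
    refine ⟨(((p - 1).factorial : k) * c ^ (p - 1))⁻¹ • (E ^ (p - 1)) v,
      S.smul_mem _ (pow_apply_mem hE _ v hv), ?_⟩
    rw [map_smul, hff _ v hfv, smul_smul, inv_mul_cancel₀ hu, one_smul]
  intro s hs
  induction s, hs using Nat.le_induction with
  | base => exact fun _ v hv hfv => hone v hv (by simpa using hfv)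
  | succ s hs ih =>
    intro hsp v hv hfv
    obtain ⟨w, hw, hwv⟩ := hone ((f ^ s) v) (pow_apply_mem hf _ v hv)
      (by rw [← Module.End.mul_apply, ← pow_succ', hfv])
    obtain ⟨w', hw', hwv'⟩ := ih (by omega) (v - (f ^ (p - (s + 1))) w)
      (S.sub_mem hv (pow_apply_mem hf _ w hw)) (by
        rw [map_sub, ← Module.End.mul_apply, ← pow_add, show s + (p - (s + 1)) = p - 1 by omega,
          hwv, sub_self])
    refine ⟨f w' + w, S.add_mem (hf _ hw') hw, ?_⟩
    rw [map_add, ← Module.End.mul_apply, ← pow_succ, show p - (s + 1) + 1 = p - s by omega, hwv']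
    abel

/-- Two-out-of-three: if the middle and right terms of a short exact sequence of `p`-complexes
have liftable kernels, so does the left term. -/
theorem KernelsLiftable.of_exact {U : Type*} [AddCommGroup U] [Module k U] {p : ℕ}
    {f : Module.End k U} {g : Module.End k V} {h : Module.End k W}
    {A : Submodule k U} {B : Submodule k V} {C : Submodule k W} {ι : U →ₗ[k] V} {φ : V →ₗ[k] W}
    (hgp : g ^ p = 0) (hgB : ∀ v ∈ B, g v ∈ B)
    (hι : ∀ u, ι (f u) = g (ι u)) (hφ : ∀ v, φ (g v) = h (φ v))
    (hinj : Function.Injective ι) (hιB : ∀ u ∈ A, ι u ∈ B) (hφι : ∀ u ∈ A, φ (ι u) = 0)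
    (hφC : ∀ v ∈ B, φ v ∈ C) (hsurj : ∀ w ∈ C, ∃ v ∈ B, φ v = w)
    (hker : ∀ v ∈ B, φ v = 0 → ∃ u ∈ A, ι u = v)
    (hB : KernelsLiftable p g B) (hC : KernelsLiftable p h C) : KernelsLiftable p f A := by
  intro s hs hsp u hu hfu
  obtain ⟨b, hb, hbu⟩ := hB s hs hsp (ι u) (hιB u hu) (by
    rw [← pow_apply_intertwine hι, hfu, map_zero])
  obtain ⟨c, hc, hcb⟩ := hC (p - s) (by omega) (by omega) (φ b) (hφC b hb) (by
    rw [← pow_apply_intertwine hφ, hbu, hφι u hu])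
  rw [Nat.sub_sub_self hsp.le] at hcb
  obtain ⟨b', hb', rfl⟩ := hsurj c hc
  obtain ⟨u', hu', hιu'⟩ := hker (b - (g ^ s) b') (B.sub_mem hb (pow_apply_mem hgB _ _ hb')) (by
    rw [map_sub, pow_apply_intertwine hφ, hcb, sub_self])
  refine ⟨u', hu', hinj ?_⟩
  rw [pow_apply_intertwine hι, hιu', map_sub, ← Module.End.mul_apply, ← pow_add,
    Nat.sub_add_cancel hsp.le, hgp, hbu]
  simp

end LinearAlgebra

/-- In characteristic `p`, the `p`-th power of a derivation satisfies the Leibniz rule. -/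
theorem Derivation.iterate_char_leibniz {k A : Type*} [Field k] [CommRing A] [Algebra k A]
    [Nontrivial A] {p : ℕ} (hp : p.Prime) [CharP k p] (D : Derivation k A A) (f g : A) :
    ((D : Module.End k A) ^ p) (f * g) =
      f * ((D : Module.End k A) ^ p) g + ((D : Module.End k A) ^ p) f * g := by
  have := Fact.mk hp
  set d : Module.End k A := (D : Module.End k A) with hd
  have : CharP (Module.End k (Module.End k A)) p :=
    charP_of_injective_algebraMap (algebraMap k _).injective p
  have hcomm : Commute (LinearMap.mulLeft k d : Module.End k (Module.End k A))
      (LinearMap.mulRight k d) := LinearMap.commute_mulLeft_right (R := k) d d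
  have hpow := sub_pow_expChar_of_commute (R := Module.End k (Module.End k A)) p hcomm
  have had (m : ℕ) : ((LinearMap.mulLeft k d - LinearMap.mulRight k d) ^ m)
      (LinearMap.mulLeft k f) = LinearMap.mulLeft k ((d ^ m) f) := by
    induction m with
    | zero => simp
    | succ m ih =>
      rw [pow_succ', Module.End.mul_apply, ih, pow_succ', Module.End.mul_apply]
      ext x
      simp [hd, mul_comm]
  have key := had p
  rw [hpow, LinearMap.pow_mulLeft, LinearMap.pow_mulRight] at key
  have := LinearMap.congr_fun key g
  simp only [LinearMap.sub_apply, LinearMap.mulLeft_apply, LinearMap.mulRight_apply,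
    Module.End.mul_apply] at this
  linear_combination this

section Symmetric

variable (k : Type*) [Field k]

/-- The derivation `∑ x_i ^ 2 ∂/∂x_i`. -/
noncomputable def sqDerivation (n : ℕ) :
    Derivation k (MvPolynomial (Fin n) k) (MvPolynomial (Fin n) k) :=
  mkDerivation k fun i => X i ^ 2

/-- The operator `∂ + a e_1`, which corresponds to `∂` on the ideal generated by `e_n ^ a`. -/
noncomputable def twistedSq (n a : ℕ) : Module.End k (MvPolynomial (Fin n) k) :=
  (sqDerivation k n).toLinearMap +
    LinearMap.mulLeft k ((a : MvPolynomial (Fin n) k) * ∑ i, X i)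

/-- The subspace of symmetric polynomials. -/
noncomputable abbrev symSubmodule (n : ℕ) : Submodule k (MvPolynomial (Fin n) k) :=
  Subalgebra.toSubmodule (symmetricSubalgebra (Fin n) k)

variable {k}

@[simp]
theorem sqDerivation_X {n : ℕ} (i : Fin n) : sqDerivation k n (X i) = X i ^ 2 :=
  mkDerivation_X ..

theorem twistedSq_apply {n a : ℕ} (g : MvPolynomial (Fin n) k) :
    twistedSq k n a g = sqDerivation k n g + (a : MvPolynomial (Fin n) k) * (∑ i, X i) * g := rfl

theorem sqDerivation_pow_char {p : ℕ} (hp : p.Prime) [CharP k p] (n : ℕ) :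
    ((sqDerivation k n).toLinearMap : Module.End k (MvPolynomial (Fin n) k)) ^ p = 0 := by
  set d : Module.End k (MvPolynomial (Fin n) k) := (sqDerivation k n).toLinearMap with hd
  have hX (m : ℕ) (i : Fin n) : (d ^ m) (X i) = (m.factorial : MvPolynomial (Fin n) k) *
      X i ^ (m + 1) := by
    induction m with
    | zero => simp
    | succ m ih =>
      rw [pow_succ', Module.End.mul_apply, ih, hd, Derivation.coeFn_coe, Derivation.leibniz,
        Derivation.leibniz_pow, sqDerivation_X, Derivation.map_natCast, Nat.factorial_succ]
      simp only [smul_eq_mul, nsmul_eq_mul, mul_zero, add_zero, Nat.add_sub_cancel]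
      push_cast
      ring
  refine LinearMap.ext fun f => ?_
  induction f using MvPolynomial.induction_on with
  | C c =>
    obtain ⟨m, rfl⟩ := Nat.exists_eq_succ_of_ne_zero hp.ne_zero
    rw [pow_succ, Module.End.mul_apply, hd, Derivation.coeFn_coe, ← algebraMap_eq,
      Derivation.map_algebraMap]
    simp
  | add f g hf hg => rw [map_add, hf, hg, map_add]
  | mul_X f i hf =>
    rw [hd, Derivation.iterate_char_leibniz hp, ← hd, hf, hX,
      (CharP.cast_eq_zero_iff (MvPolynomial (Fin n) k) p _).2 (Nat.dvd_factorial hp.pos le_rfl)]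
    simp

theorem esymm_self (n : ℕ) : esymm (Fin n) k n = ∏ i, X i := by
  have := Finset.powersetCard_self (Finset.univ : Finset (Fin n))
  rw [Finset.card_univ, Fintype.card_fin] at this
  rw [esymm, this, Finset.sum_singleton]

theorem sqDerivation_prod_X {n : ℕ} (s : Finset (Fin n)) :
    sqDerivation k n (∏ i ∈ s, X i) = (∑ i ∈ s, X i) * ∏ i ∈ s, X i := by
  classical
  induction s using Finset.induction_on with
  | empty => simp
  | insert i s hi ih =>
    rw [Finset.prod_insert hi, Finset.sum_insert hi, Derivation.leibniz, ih, sqDerivation_X]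
    simp only [smul_eq_mul]
    ring

theorem prod_X_mul_twistedSq {n a : ℕ} (g : MvPolynomial (Fin n) k) :
    (∏ i, X i) * twistedSq k n (a + 1) g = twistedSq k n a ((∏ i, X i) * g) := by
  rw [twistedSq_apply, twistedSq_apply, Derivation.leibniz, sqDerivation_prod_X]
  simp only [smul_eq_mul]
  push_cast
  ring

theorem prod_X_ne_zero (n : ℕ) : (∏ i, X i : MvPolynomial (Fin n) k) ≠ 0 :=
  Finset.prod_ne_zero_iff.2 fun i _ => X_ne_zero i

theorem prod_X_pow_mul_twistedSq {n a : ℕ} (g : MvPolynomial (Fin n) k) :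
    (∏ i, X i) ^ a * twistedSq k n a g = sqDerivation k n ((∏ i, X i) ^ a * g) := by
  induction a generalizing g with
  | zero => simp [twistedSq_apply]
  | succ a ih => rw [pow_succ, mul_assoc, prod_X_mul_twistedSq, ih, mul_assoc]

theorem prod_X_pow_mul_twistedSq_pow {n a : ℕ} (m : ℕ) (g : MvPolynomial (Fin n) k) :
    (∏ i, X i) ^ a * (twistedSq k n a ^ m) g =
      (((sqDerivation k n).toLinearMap : Module.End k (MvPolynomial (Fin n) k)) ^ m)
        ((∏ i, X i) ^ a * g) :=
  pow_apply_intertwine (φ := LinearMap.mulLeft k ((∏ i, X i) ^ a))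
    (fun v => prod_X_pow_mul_twistedSq v) m g

theorem twistedSq_pow_char {p : ℕ} (hp : p.Prime) [CharP k p] (n a : ℕ) :
    twistedSq k n a ^ p = 0 := by
  refine LinearMap.ext fun g => ?_
  have := prod_X_pow_mul_twistedSq_pow (a := a) p g
  rw [sqDerivation_pow_char hp] at this
  exact (mul_eq_zero.1 this).resolve_left (pow_ne_zero _ (prod_X_ne_zero n))

theorem rename_sqDerivation {n : ℕ} (σ : Equiv.Perm (Fin n)) (g : MvPolynomial (Fin n) k) :
    rename σ (sqDerivation k n g) = sqDerivation k n (rename σ g) := by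
  induction g using MvPolynomial.induction_on with
  | C c => simp [← algebraMap_eq]
  | add f g hf hg => simp only [map_add, hf, hg]
  | mul_X f i hf => simp [Derivation.leibniz, hf]

theorem twistedSq_mem {n a : ℕ} (g : MvPolynomial (Fin n) k) (hg : g ∈ symSubmodule k n) :
    twistedSq k n a g ∈ symSubmodule k n := by
  intro σ
  have hg' : rename σ g = g := hg σ
  rw [twistedSq_apply, map_add, rename_sqDerivation, map_mul, map_mul, hg', map_natCast, map_sum]
  simp only [rename_X]
  rw [Equiv.sum_comp σ (fun i => (X i : MvPolynomial (Fin n) k))]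

/-- Truncated division by the variable `x_i`. -/
noncomputable def divX {n : ℕ} (i : Fin n) : Module.End k (MvPolynomial (Fin n) k) where
  toFun g := g.divMonomial (Finsupp.single i 1)
  map_add' _ _ := add_divMonomial _ _ _
  map_smul' c g := by
    ext m
    simp [coeff_divMonomial]

theorem divX_monomial_add {n : ℕ} (i : Fin n) (m : Fin n →₀ ℕ) (r : k) :
    divX i (monomial (m + Finsupp.single i 1) r) = monomial m r := by
  change divMonomial _ _ = _
  ext t
  rw [coeff_divMonomial, add_comm, coeff_monomial, coeff_monomial]
  simp

theorem divX_monomial_eq_zero {n : ℕ} {i : Fin n} {m : Fin n →₀ ℕ} (hm : m i = 0) (r : k) :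
    divX i (monomial m r) = 0 := by
  change divMonomial _ _ = _
  ext t
  rw [coeff_divMonomial, coeff_monomial, if_neg, coeff_zero]
  rintro rfl
  simp at hm

theorem rename_divX {n : ℕ} (σ : Equiv.Perm (Fin n)) (i : Fin n) (g : MvPolynomial (Fin n) k) :
    rename σ (divX i g) = divX (σ i) (rename σ g) := by
  induction g using MvPolynomial.induction_on' with
  | add f g hf hg => simp only [map_add, hf, hg]
  | monomial m r =>
    rw [rename_monomial]
    by_cases hm : m i = 0
    · rw [divX_monomial_eq_zero hm, divX_monomial_eq_zero, map_zero]
      rwa [Finsupp.mapDomain_apply σ.injective]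
    · obtain ⟨t, rfl⟩ : ∃ t, m = t + Finsupp.single i 1 :=
        ⟨m - Finsupp.single i 1, (tsub_add_cancel_of_le (by
          simpa using Nat.one_le_iff_ne_zero.2 hm)).symm⟩
      rw [Finsupp.mapDomain_add, Finsupp.mapDomain_single, divX_monomial_add, divX_monomial_add,
        rename_monomial]

theorem twistedSq_one_monomial {n : ℕ} (m : Fin n →₀ ℕ) (r : k) :
    twistedSq k n 1 (monomial m r) =
      ∑ j, monomial (m + Finsupp.single j 1) (((m j : k) + 1) * r) := by
  rw [twistedSq_apply, sqDerivation, mkDerivation_monomial, Finsupp.sum_fintype _ _ (by simp),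
    Finset.smul_sum, Nat.cast_one, one_mul, Finset.sum_mul, ← Finset.sum_add_distrib]
  refine Finset.sum_congr rfl fun j _ => ?_
  have hX : (X j : MvPolynomial (Fin n) k) * monomial m r =
      monomial (m + Finsupp.single j 1) r := by
    rw [X, monomial_mul, one_mul, add_comm]
  rw [hX, add_mul, one_mul, map_add]
  congr 1
  by_cases hm : m j = 0
  · simp [hm]
  · obtain ⟨t, rfl⟩ : ∃ t, m = t + Finsupp.single j 1 :=
      ⟨m - Finsupp.single j 1, (tsub_add_cancel_of_le (by
        simpa using Nat.one_le_iff_ne_zero.2 hm)).symm⟩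
    rw [add_tsub_cancel_right, X_pow_eq_monomial, smul_eq_mul, monomial_mul, smul_monomial,
      add_assoc, ← Finsupp.single_add]
    simp [mul_comm]

theorem twistedSq_one_divX {n : ℕ} (i : Fin n) (g : MvPolynomial (Fin n) k) :
    twistedSq k n 1 (divX i g) = divX i (twistedSq k n 1 g) - g := by
  induction g using MvPolynomial.induction_on' with
  | add f g hf hg => simp only [map_add, hf, hg]; abel
  | monomial m r =>
    rw [twistedSq_one_monomial, map_sum]
    by_cases hm : m i = 0
    · rw [divX_monomial_eq_zero hm, Finset.sum_eq_single i, divX_monomial_add, hm]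
      · simp
      · intro j _ hj
        exact divX_monomial_eq_zero (by simp [hm, Finsupp.single_eq_of_ne hj.symm]) _
      · simp
    · obtain ⟨t, rfl⟩ : ∃ t, m = t + Finsupp.single i 1 :=
        ⟨m - Finsupp.single i 1, (tsub_add_cancel_of_le (by
          simpa using Nat.one_le_iff_ne_zero.2 hm)).symm⟩
      rw [divX_monomial_add, twistedSq_one_monomial, eq_sub_iff_add_eq, ← eq_sub_iff_add_eq',
        ← Finset.sum_sub_distrib, Finset.sum_eq_single i]
      · rw [add_right_comm, divX_monomial_add, ← map_sub]
        congr 1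
        simp
        ring
      · intro j _ hj
        rw [add_right_comm, divX_monomial_add, ← map_sub]
        simp [Finsupp.single_eq_of_ne hj]
      · simp

theorem kernelsLiftable_twistedSq_one {p : ℕ} (hp : p.Prime) [CharP k p] {n : ℕ} (hn : 1 ≤ n)
    (hnp : n < p) : KernelsLiftable p (twistedSq k n 1) (symSubmodule k n) := by
  refine KernelsLiftable.of_weyl hp (E := ∑ i, divX i) (c := -(n : k)) twistedSq_mem ?_ ?_ ?_
  · intro g hg σ
    have hg' : rename σ g = g := hg σ
    rw [LinearMap.sum_apply, map_sum]
    simp only [rename_divX, hg']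
    exact Equiv.sum_comp σ fun i => divX i g
  · rw [neg_ne_zero, Ne, CharP.cast_eq_zero_iff k p]
    exact fun h => absurd (Nat.le_of_dvd hn h) (by omega)
  · intro g
    simp only [LinearMap.sum_apply, map_sum, twistedSq_one_divX, Finset.sum_sub_distrib]
    simp [sub_eq_add_neg, Nat.cast_smul_eq_nsmul]

/-- Setting the first variable to zero. -/
noncomputable def dropVar (n : ℕ) : MvPolynomial (Fin (n + 1)) k →ₐ[k] MvPolynomial (Fin n) k :=
  aeval (Fin.cons 0 X)

@[simp]
theorem dropVar_X_zero (n : ℕ) : dropVar n (X 0 : MvPolynomial (Fin (n + 1)) k) = 0 := by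
  simp [dropVar]

@[simp]
theorem dropVar_X_succ {n : ℕ} (i : Fin n) :
    dropVar n (X i.succ : MvPolynomial (Fin (n + 1)) k) = X i := by
  simp [dropVar]

theorem dropVar_sqDerivation {n : ℕ} (g : MvPolynomial (Fin (n + 1)) k) :
    dropVar n (sqDerivation k (n + 1) g) = sqDerivation k n (dropVar n g) := by
  induction g using MvPolynomial.induction_on with
  | C c => simp [← algebraMap_eq]
  | add f g hf hg => simp only [map_add, hf, hg]
  | mul_X f i hf =>
    cases i using Fin.cases <;> simp [Derivation.leibniz, hf]

theorem dropVar_twistedSq {n a : ℕ} (g : MvPolynomial (Fin (n + 1)) k) :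
    dropVar n (twistedSq k (n + 1) a g) = twistedSq k n a (dropVar n g) := by
  simp [twistedSq_apply, dropVar_sqDerivation, Fin.sum_univ_succ]

theorem dropVar_esymm (n j : ℕ) :
    dropVar n (esymm (Fin (n + 1)) k j) = esymm (Fin n) k j := by
  rw [dropVar, aeval_esymm_eq_multiset_esymm, esymm_eq_multiset_esymm]
  have : (Finset.univ : Finset (Fin (n + 1))).val.map
      (Fin.cons 0 X : Fin (n + 1) → MvPolynomial (Fin n) k) =
      0 ::ₘ (Finset.univ : Finset (Fin n)).val.map X := by
    rw [Fin.univ_succ]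
    simp
  rw [this]
  cases j with
  | zero => simp [Multiset.esymm]
  | succ j => 
    rw [Multiset.esymm, Multiset.powersetCard_cons, Multiset.map_add, Multiset.sum_add,
      Multiset.map_map]
    simp [Multiset.esymm]

theorem dropVar_mem {n : ℕ} (g : MvPolynomial (Fin (n + 1)) k) (hg : g ∈ symSubmodule k (n + 1)) :
    dropVar n g ∈ symSubmodule k n := by
  intro σ
  have hg' := hg (Equiv.Perm.decomposeFin.symm (0, σ))
  conv_rhs => rw [← hg']
  rw [← AlgHom.comp_apply, ← AlgHom.comp_apply]
  congr 1
  ext1 i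
  cases i using Fin.cases <;> simp

theorem exists_dropVar_eq {n : ℕ} (g : MvPolynomial (Fin n) k) (hg : g ∈ symSubmodule k n) :
    ∃ f ∈ symSubmodule k (n + 1), dropVar n f = g := by
  obtain ⟨P, hP⟩ := esymmAlgHom_surjective (σ := Fin n) k (n := n) (by simp) ⟨g, hg⟩
  refine ⟨esymmAlgHom (Fin (n + 1)) k n P, (esymmAlgHom (Fin (n + 1)) k n P).2, ?_⟩
  have hP' : (esymmAlgHom (Fin n) k n P : MvPolynomial (Fin n) k) = g := congrArg Subtype.val hP
  rw [← hP', esymmAlgHom_apply, esymmAlgHom_apply, ← AlgHom.comp_apply]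
  congr 1
  ext1 i
  simp [dropVar_esymm]

theorem X_zero_dvd_of_dropVar {n : ℕ} {g : MvPolynomial (Fin (n + 1)) k} (h : dropVar n g = 0) :
    X 0 ∣ g := by
  have hd : dropVar n = ((Polynomial.aeval (0 : MvPolynomial (Fin n) k)).restrictScalars k).comp
      (MvPolynomial.finSuccEquiv k n).toAlgHom := by
    ext1 i
    cases i using Fin.cases <;> simp [finSuccEquiv_X_zero, finSuccEquiv_X_succ]
  rw [← map_dvd_iff (MvPolynomial.finSuccEquiv k n), finSuccEquiv_X_zero, Polynomial.X_dvd_iff,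
    Polynomial.coeff_zero_eq_aeval_zero]
  rwa [hd] at h

theorem prod_X_dvd {n : ℕ} {g : MvPolynomial (Fin n) k} (h : ∀ i, X i ∣ g) (s : Finset (Fin n)) :
    ∏ i ∈ s, X i ∣ g := by
  classical
  induction s using Finset.induction_on with
  | empty => simp
  | insert i s hi ih =>
    obtain ⟨q, rfl⟩ := ih
    rw [Finset.prod_insert hi, mul_comm]
    refine mul_dvd_mul_left _ (((X_prime (R := k) (i := i)).dvd_or_dvd (h i)).resolve_left ?_)
    intro hd
    obtain ⟨j, hj, hij⟩ := (X_prime.dvd_finsetProd_iff _).1 hd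
    exact hi ((X_dvd_X.1 hij) ▸ hj)

theorem exists_eq_prod_X_mul {n : ℕ} (g : MvPolynomial (Fin (n + 1)) k)
    (hg : g ∈ symSubmodule k (n + 1)) (h : dropVar n g = 0) :
    ∃ f ∈ symSubmodule k (n + 1), (∏ i, X i) * f = g := by
  have hX (i : Fin (n + 1)) : X i ∣ g := by
    have := map_dvd (rename (Equiv.swap 0 i)) (X_zero_dvd_of_dropVar h)
    rwa [hg (Equiv.swap 0 i), rename_X, Equiv.swap_apply_left] at this
  obtain ⟨f, rfl⟩ := prod_X_dvd hX Finset.univ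
  refine ⟨f, fun σ => mul_left_cancel₀ (prod_X_ne_zero (n + 1)) ?_, rfl⟩
  have hσ := hg σ
  rw [map_mul, map_prod] at hσ
  simp only [rename_X] at hσ
  rwa [Equiv.prod_comp σ (fun i => (X i : MvPolynomial (Fin (n + 1)) k))] at hσ

theorem kernelsLiftable_twistedSq {p : ℕ} (hp : p.Prime) [CharP k p] {n a : ℕ} (ha : 1 ≤ a)
    (han : a ≤ n) (hnp : n < p) : KernelsLiftable p (twistedSq k n a) (symSubmodule k n) := by
  induction a, ha using Nat.le_induction generalizing n with
  | base => exact kernelsLiftable_twistedSq_one hp han hnp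
  | succ a ha ih =>
    obtain ⟨n, rfl⟩ : ∃ m, n = m + 1 := ⟨n - 1, by omega⟩
    refine KernelsLiftable.of_exact (ι := LinearMap.mulLeft k (∏ i, X i))
      (φ := (dropVar n).toLinearMap) (twistedSq_pow_char hp (n + 1) a) twistedSq_mem
      prod_X_mul_twistedSq dropVar_twistedSq (mul_right_injective₀ (prod_X_ne_zero (n + 1)))
      ?_ ?_ dropVar_mem exists_dropVar_eq exists_eq_prod_X_mul
      (ih (by omega) hnp) (ih (by omega) (by omega))
    · intro g hg
      refine Subalgebra.mul_mem _ ?_ hg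
      rw [← esymm_self]
      exact esymm_isSymmetric (Fin (n + 1)) k (n + 1)
    · intro g _
      simp [Fin.prod_univ_succ]

end Symmetric

/-- For `1 ≤ a ≤ n < p`, the ideal `J = e_n^a · Sym_n` of the algebra of symmetric
polynomials generated by `e_n^a`, as a `p`-complex under `∂`, is acyclic: for all
`1 ≤ s ≤ p-1`, the kernel of `∂^s` on `J` equals the image of `∂^{p-s}` on `J`. -/
theorem stmt4 (p : ℕ) (hp : p.Prime) (k : Type*) [Field k] [CharP k p]
    (n a : ℕ) (ha1 : 1 ≤ a) (han : a ≤ n) (hnp : n < p)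
    (D : Derivation k (MvPolynomial (Fin n) k) (MvPolynomial (Fin n) k))
    (hD : ∀ i, D (X i) = X i ^ 2)
    (J : Set (MvPolynomial (Fin n) k))
    (hJ : J = (fun g => esymm (Fin n) k n ^ a * g) '' {g | g.IsSymmetric}) :
    ∀ s : ℕ, 1 ≤ s → s ≤ p - 1 →
      {f | f ∈ J ∧ (⇑D)^[s] f = 0} = (⇑D)^[p - s] '' J := by
  obtain rfl : D = sqDerivation k n := derivation_ext fun i => by rw [hD, sqDerivation_X]
  have hiter (m : ℕ) (g : MvPolynomial (Fin n) k) :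
      (⇑(sqDerivation k n))^[m] ((∏ i, X i) ^ a * g) =
      (∏ i, X i) ^ a * (twistedSq k n a ^ m) g := by
    rw [prod_X_pow_mul_twistedSq_pow, Module.End.pow_apply, Derivation.coeFn_coe]
  intro s hs hsp
  have hpp := hp.pos
  subst hJ
  rw [esymm_self]
  apply Set.Subset.antisymm
  · rintro _ ⟨⟨g, hg, rfl⟩, hgs⟩
    obtain ⟨h, hh, rfl⟩ := kernelsLiftable_twistedSq hp ha1 han hnp s hs (by omega) g hg
      ((mul_eq_zero.1 ((hiter s g).symm.trans hgs)).resolve_left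
        (pow_ne_zero _ (prod_X_ne_zero n)))
    exact ⟨_, ⟨h, hh, rfl⟩, hiter _ _⟩
  · rintro _ ⟨_, ⟨g, hg, rfl⟩, rfl⟩
    refine ⟨⟨(twistedSq k n a ^ (p - s)) g, pow_apply_mem twistedSq_mem _ g hg,
      (hiter _ _).symm⟩, ?_⟩
    rw [← Function.iterate_add_apply, Nat.add_sub_cancel' (by omega), hiter,
      twistedSq_pow_char hp]
    simp
end

section
/- Let k be a field of characteristic p (p prime) and suppose 1 ≤ a ≤ n < p. Then the rank-one twisted p-complex (Sym_n, D_a), where D_a(f) = ∂(f) + a·e_1·f (the coefficient a cast from ℕ into k), is acyclic: for every s with 1 ≤ s ≤ p−1, {f ∈ Sym_n : D_a^s f = 0} = D_a^{p−s}(Sym_n). (This is the acyclicity of the rank-one p-DG module S_n(a) = Sym_n·v_a with ∂(v_a) = a·e_1·v_a.) -/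
open MvPolynomial

section Abstract

variable {k M : Type*} [Field k] [AddCommGroup M] [Module k M]

/-- On a submodule where `[D, H] = 1`, a vector killed by `D` satisfies `D ^ j (H ^ j v) = j! v`. -/
theorem pow_apply_pow_apply_of_commutator_eq_one (A : Submodule k M) (D H : Module.End k M)
    (hH : ∀ v ∈ A, H v ∈ A) (hDH : ∀ v ∈ A, D (H v) = H (D v) + v)
    {v : M} (hv : v ∈ A) (hDv : D v = 0) (j : ℕ) :
    (D ^ j) ((H ^ j) v) = (j.factorial : k) • v := by
  have mem : ∀ j : ℕ, (H ^ j) v ∈ A := fun j => by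
    induction j with
    | zero => simpa using hv
    | succ j ih => rw [pow_succ', Module.End.mul_apply]; exact hH _ ih
  have step : ∀ j : ℕ, D ((H ^ (j + 1)) v) = ((j + 1 : ℕ) : k) • (H ^ j) v := fun j => by
    induction j with
    | zero => simp [hDH v hv, hDv]
    | succ j ih =>
      rw [pow_succ', Module.End.mul_apply, hDH _ (mem _), ih, map_smul, ← Module.End.mul_apply,
        ← pow_succ']
      push_cast
      module
  induction j with
  | zero => simp
  | succ j ih =>
    rw [pow_succ, Module.End.mul_apply, step, map_smul, ih, smul_smul, Nat.factorial_succ]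
    push_cast
    rfl

theorem exists_pow_apply_eq_of_commutator_eq_one (p : ℕ) (hp : p.Prime) [CharP k p]
    (A : Submodule k M) (D H : Module.End k M) (hD : ∀ v ∈ A, D v ∈ A)
    (hH : ∀ v ∈ A, H v ∈ A) (hDH : ∀ v ∈ A, D (H v) = H (D v) + v)
    (s : ℕ) (hs : 1 ≤ s) (hsp : s ≤ p - 1) (v : M) (hv : v ∈ A) (hsv : (D ^ s) v = 0) :
    ∃ u ∈ A, (D ^ (p - s)) u = v := by
  have pow_mem : ∀ (T : Module.End k M), (∀ v ∈ A, T v ∈ A) → ∀ (j : ℕ), ∀ v ∈ A,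
      (T ^ j) v ∈ A := fun T hT j => by
    induction j with
    | zero => simp
    | succ j ih => intro v hv; rw [pow_succ', Module.End.mul_apply]; exact hT _ (ih v hv)
  have base : ∀ v ∈ A, D v = 0 → ∃ u ∈ A, (D ^ (p - 1)) u = v := by
    intro v hv hDv
    have hfac : ((p - 1).factorial : k) ≠ 0 := by
      rw [Ne, CharP.cast_eq_zero_iff k p, hp.dvd_factorial]
      have := hp.pos
      omega
    refine ⟨((p - 1).factorial : k)⁻¹ • (H ^ (p - 1)) v, A.smul_mem _ (pow_mem H hH _ v hv), ?_⟩
    rw [map_smul, pow_apply_pow_apply_of_commutator_eq_one A D H hH hDH hv hDv, smul_smul,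
      inv_mul_cancel₀ hfac, one_smul]
  induction s, hs using Nat.le_induction generalizing v with
  | base => exact base v hv (by simpa using hsv)
  | succ s hs ih =>
    obtain ⟨u, hu, huv⟩ := base ((D ^ s) v) (pow_mem D hD s v hv)
      (by rw [← Module.End.mul_apply, ← pow_succ', hsv])
    obtain ⟨w, hw, hwv⟩ := ih (by omega) (v - (D ^ (p - (s + 1))) u)
      (A.sub_mem hv (pow_mem D hD _ u hu))
      (by rw [map_sub, ← Module.End.mul_apply, ← pow_add,
            show s + (p - (s + 1)) = p - 1 by omega, huv, sub_self])
    refine ⟨u + D w, A.add_mem hu (hD w hw), ?_⟩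
    rw [map_add, ← Module.End.mul_apply, ← pow_succ, show p - (s + 1) + 1 = p - s by omega, hwv]
    abel

end Abstract

section Operators

variable {σ k : Type*} [Field k]

/-- The linear endomorphism sending `x ^ m` to `w (m i) • x ^ (m + e_i)`. -/
noncomputable def raiseOp (w : ℕ → k) (i : σ) : Module.End k (MvPolynomial σ k) :=
  (basisMonomials σ k).constr k fun m => monomial (m + Finsupp.single i 1) (w (m i))

/-- The linear endomorphism sending `x ^ m` to `w (m i) • x ^ (m - e_i)`. -/
noncomputable def lowerOp (w : ℕ → k) (i : σ) : Module.End k (MvPolynomial σ k) :=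
  (basisMonomials σ k).constr k fun m => monomial (m - Finsupp.single i 1) (w (m i))

/-- The linear endomorphism scaling `x ^ m` by `w m`. -/
noncomputable def diagOp (w : (σ →₀ ℕ) → k) : Module.End k (MvPolynomial σ k) :=
  (basisMonomials σ k).constr k fun m => monomial m (w m)

@[simp]
theorem raiseOp_monomial (w : ℕ → k) (i : σ) (m : σ →₀ ℕ) (r : k) :
    raiseOp w i (monomial m r) = monomial (m + Finsupp.single i 1) (r * w (m i)) := by
  have h := (basisMonomials σ k).constr_basis k
    (fun m => monomial (m + Finsupp.single i 1) (w (m i))) m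
  rw [coe_basisMonomials] at h
  rw [← mul_one r, ← smul_eq_mul, ← smul_monomial, map_smul, raiseOp, h, smul_monomial]
  simp

@[simp]
theorem lowerOp_monomial (w : ℕ → k) (i : σ) (m : σ →₀ ℕ) (r : k) :
    lowerOp w i (monomial m r) = monomial (m - Finsupp.single i 1) (r * w (m i)) := by
  have h := (basisMonomials σ k).constr_basis k
    (fun m => monomial (m - Finsupp.single i 1) (w (m i))) m
  rw [coe_basisMonomials] at h
  rw [← mul_one r, ← smul_eq_mul, ← smul_monomial, map_smul, lowerOp, h, smul_monomial]
  simp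

@[simp]
theorem diagOp_monomial (w : (σ →₀ ℕ) → k) (m : σ →₀ ℕ) (r : k) :
    diagOp w (monomial m r) = monomial m (r * w m) := by
  have h := (basisMonomials σ k).constr_basis k (fun m => monomial m (w m)) m
  rw [coe_basisMonomials] at h
  rw [← mul_one r, ← smul_eq_mul, ← smul_monomial, map_smul, diagOp, h, smul_monomial]
  simp

theorem end_ext_monomial {S T : Module.End k (MvPolynomial σ k)}
    (h : ∀ m, S (monomial m 1) = T (monomial m 1)) : S = T :=
  (basisMonomials σ k).ext fun m => by simpa using h m

theorem raiseOp_commute_raiseOp (v w : ℕ → k) (i j : σ) (hij : i ≠ j) :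
    Commute (raiseOp v i) (raiseOp w j) := by
  refine end_ext_monomial fun m => ?_
  simp only [Module.End.mul_apply, raiseOp_monomial]
  simp [hij, hij.symm, add_right_comm, mul_comm]

theorem raiseOp_commute_lowerOp (v w : ℕ → k) (hw : w 0 = 0) (i j : σ) (hij : i ≠ j) :
    Commute (raiseOp v i) (lowerOp w j) := by
  classical
  refine end_ext_monomial fun m => ?_
  simp only [Module.End.mul_apply, raiseOp_monomial, lowerOp_monomial]
  by_cases hm : m j = 0
  · simp [hij, hij.symm, hm, hw]
  · congr 1
    · congr 1
      ext t
      by_cases h1 : t = j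
      · subst h1; simp [hij]
      · simp [Finsupp.single_apply, Ne.symm h1]
    · simp [hij, hij.symm, mul_comm]

theorem raiseOp_pow_monomial (w : ℕ → k) (i : σ) (m : σ →₀ ℕ) (t : ℕ) :
    (raiseOp w i ^ t) (monomial m 1) =
      monomial (m + Finsupp.single i t) (∏ j ∈ Finset.range t, w (m i + j)) := by
  induction t with
  | zero => simp
  | succ t ih =>
    rw [pow_succ', Module.End.mul_apply, ih, raiseOp_monomial, Finset.prod_range_succ,
      add_assoc, ← Finsupp.single_add]
    simp

theorem sum_pow_char_eq_zero {R ι : Type*} [Ring R] (p : ℕ) (hp : p.Prime) [CharP R p]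
    (s : Finset ι) (f : ι → R) (hcomm : ∀ i j, i ≠ j → Commute (f i) (f j))
    (hf : ∀ i, f i ^ p = 0) : (∑ i ∈ s, f i) ^ p = 0 := by
  classical
  have := Fact.mk hp
  induction s using Finset.induction_on with
  | empty => simp [hp.ne_zero]
  | insert i s hi ih =>
    rw [Finset.sum_insert hi, add_pow_char_of_commute p, hf, ih, add_zero]
    exact Commute.sum_right _ _ _ fun j hj => hcomm _ _ fun h => hi (h ▸ hj)

/-- `x_i ^ 2 ∂/∂x_i + (1 - c) x_i`. -/
noncomputable abbrev varRaise (k : Type*) [Field k] (c : ℕ) (i : σ) :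
    Module.End k (MvPolynomial σ k) :=
  raiseOp (fun m => (m : k) + 1 - c) i

/-- Homotopy in the variable `x_i`: `x_i ^ m ↦ - x_i ^ (m - 1)` for `m > c`, and `0` otherwise. -/
noncomputable abbrev varLower (k : Type*) [Field k] (c : ℕ) (i : σ) :
    Module.End k (MvPolynomial σ k) :=
  lowerOp (fun m => if c < m then -1 else 0) i

theorem varRaise_pow_char (p : ℕ) (hp : p.Prime) [CharP k p] (c : ℕ) (i : σ) :
    varRaise k c i ^ p = 0 := by
  refine end_ext_monomial fun m => ?_
  rw [raiseOp_pow_monomial]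
  have := Fact.mk hp
  have : ∃ j ∈ Finset.range p, ((m i + j : ℕ) : k) + 1 - c = 0 := by
    refine ⟨((c : ZMod p) - (m i + 1)).val, Finset.mem_range.2 (ZMod.val_lt _), ?_⟩
    have h : (((m i + ((c : ZMod p) - (m i + 1)).val + 1 : ℕ)) : ZMod p) = (c : ℕ) := by
      push_cast
      rw [ZMod.natCast_zmod_val]
      ring
    rw [ZMod.natCast_eq_natCast_iff, ← CharP.natCast_eq_natCast k p] at h
    rw [← h]
    push_cast
    ring
  obtain ⟨j, hj, h0⟩ := this
  rw [Finset.prod_eq_zero hj h0]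
  simp

theorem varRaise_mul_varLower (c : ℕ) (i : σ) :
    varRaise k c i * varLower k c i =
      varLower k c i * varRaise k c i + diagOp fun m => if c ≤ m i then 1 else 0 := by
  refine end_ext_monomial fun m => ?_
  simp only [Module.End.mul_apply, LinearMap.add_apply, raiseOp_monomial, lowerOp_monomial,
    diagOp_monomial, add_tsub_cancel_right]
  rw [← map_add]
  rcases lt_trichotomy c (m i) with h | h | h
  · have hle : Finsupp.single i 1 ≤ m := by simpa using (by omega : 1 ≤ m i)
    rw [tsub_add_cancel_of_le hle]
    have h1 : 1 ≤ m i := by omega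
    simp [h, h.le, Nat.lt_succ_of_lt h, Nat.cast_sub h1]
    abel
  · simp [h]
  · rcases Nat.lt_or_ge (m i + 1) c with h' | h'
    · simp [h.not_ge, h.not_gt, h'.not_gt]
    · have hc : c = m i + 1 := by omega
      simp [hc]

theorem varRaise_apply (c : ℕ) (i : σ) (f : MvPolynomial σ k) :
    varRaise k c i f = X i ^ 2 * pderiv i f + C (1 - c : k) * (X i * f) := by
  have : varRaise k c i = LinearMap.mulLeft k (X i ^ 2) * (pderiv i).toLinearMap +
      (1 - c : k) • LinearMap.mulLeft k (X i) := by
    refine end_ext_monomial fun m => ?_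
    have h : (X i ^ 2 * pderiv i (monomial m 1) : MvPolynomial σ k) =
        X i * (m i • monomial m 1) := by
      rw [← X_mul_pderiv_monomial, pow_two, mul_assoc]
    simp only [raiseOp_monomial, LinearMap.add_apply, Module.End.mul_apply, LinearMap.smul_apply,
      LinearMap.mulLeft_apply, Derivation.coeFn_coe, h]
    rw [X, smul_monomial, monomial_mul, monomial_mul, smul_monomial, ← map_add, add_comm m]
    congr 1
    simp
    ring
  rw [this, ← smul_eq_C_mul]
  rfl

theorem rename_comp_eq_of_monomial (τ : Equiv.Perm σ) (S T : Module.End k (MvPolynomial σ k))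
    (h : ∀ m, rename τ (S (monomial m 1)) = T (monomial (m.mapDomain τ) 1))
    (f : MvPolynomial σ k) : rename τ (S f) = T (rename τ f) := by
  have : (rename τ).toLinearMap ∘ₗ S = T ∘ₗ (rename τ : _ →ₐ[k] _).toLinearMap :=
    (basisMonomials σ k).ext fun m => by simpa [rename_monomial] using h m
  exact LinearMap.congr_fun this f

variable [Fintype σ]

theorem sum_varRaise_mul_sum_varLower (c : ℕ) :
    (∑ i : σ, varRaise k c i) * ∑ i : σ, varLower k c i =
      (∑ i : σ, varLower k c i) * (∑ i : σ, varRaise k c i) +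
        ∑ i : σ, diagOp fun m => if c ≤ m i then 1 else 0 := by
  classical
  rw [← sub_eq_iff_eq_add']
  simp only [Finset.sum_mul_sum]
  rw [Finset.sum_comm (f := fun i j : σ => varLower k c i * varRaise k c j),
    ← Finset.sum_sub_distrib]
  refine Finset.sum_congr rfl fun i _ => ?_
  rw [← Finset.sum_sub_distrib, Finset.sum_eq_single i]
  · rw [varRaise_mul_varLower, add_sub_cancel_left]
  · intro j _ hj
    rw [sub_eq_zero]
    exact raiseOp_commute_lowerOp _ _ (by simp) i j hj.symm
  · simp

/-- The number of exponents of `m` that are at least `c`, as an element of `k`. -/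
def countGE (k : Type*) [Field k] (c : ℕ) (m : σ →₀ ℕ) : k :=
  ∑ i, if c ≤ m i then 1 else 0

theorem sum_varRaise_commute_diagOp (c : ℕ) :
    Commute (∑ i : σ, varRaise k c i) (diagOp fun m => (countGE k c m)⁻¹) := by
  classical
  refine Commute.sum_left _ _ _ fun i _ => end_ext_monomial fun m => ?_
  simp only [Module.End.mul_apply, raiseOp_monomial, diagOp_monomial]
  by_cases h : m i + 1 = c
  · simp [← h]
  · have : countGE k c (m + Finsupp.single i 1) = countGE k c m := by
      refine Finset.sum_congr rfl fun j _ => ?_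
      by_cases hj : i = j
      · subst hj
        have : c ≤ m i + 1 ↔ c ≤ m i := by omega
        simp [this]
      · simp [hj]
    rw [this, mul_right_comm]

/-- The twisted differential `∑ (x_i ^ 2 ∂/∂x_i + (1 - c) x_i)`. -/
noncomputable def twistedDiff (σ k : Type*) [Field k] [Fintype σ] (c : ℕ) :
    Module.End k (MvPolynomial σ k) :=
  ∑ i : σ, varRaise k c i

/-- A contracting homotopy for `twistedDiff` on monomials with `countGE` nonzero. -/
noncomputable def homotopy (σ k : Type*) [Field k] [Fintype σ] (c : ℕ) :
    Module.End k (MvPolynomial σ k) :=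
  (∑ i : σ, varLower k c i) * diagOp fun m => (countGE k c m)⁻¹

theorem twistedDiff_homotopy (c : ℕ) (f : MvPolynomial σ k)
    (hf : ∀ m ∈ f.support, countGE k c m ≠ 0) :
    twistedDiff σ k c (homotopy σ k c f) = homotopy σ k c (twistedDiff σ k c f) + f := by
  have key : twistedDiff σ k c * homotopy σ k c = homotopy σ k c * twistedDiff σ k c +
      (∑ i : σ, diagOp fun m => if c ≤ m i then 1 else 0) *
        diagOp fun m => (countGE k c m)⁻¹ := by
    rw [twistedDiff, homotopy, ← mul_assoc, sum_varRaise_mul_sum_varLower, add_mul,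
      mul_assoc, mul_assoc, (sum_varRaise_commute_diagOp c).eq]
  have hf' : ((∑ i : σ, diagOp fun m => if c ≤ m i then 1 else 0) *
        diagOp fun m => (countGE k c m)⁻¹ : Module.End k (MvPolynomial σ k)) f = f := by
    conv_rhs => rw [f.as_sum]
    conv_lhs => rw [f.as_sum]
    rw [map_sum]
    refine Finset.sum_congr rfl fun m hm => ?_
    simp only [Module.End.mul_apply, LinearMap.sum_apply, diagOp_monomial]
    rw [← map_sum, ← Finset.mul_sum, mul_assoc, ← countGE, inv_mul_cancel₀ (hf m hm), mul_one]
  have := LinearMap.congr_fun key f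
  rwa [LinearMap.add_apply, hf'] at this

theorem twistedDiff_pow_char (p : ℕ) (hp : p.Prime) [CharP k p] (c : ℕ) :
    twistedDiff σ k c ^ p = 0 := by
  have : CharP (Module.End k (MvPolynomial σ k)) p :=
    charP_of_injective_algebraMap (algebraMap k _).injective p
  exact sum_pow_char_eq_zero p hp _ _ (fun i j hij => raiseOp_commute_raiseOp _ _ i j hij)
    (varRaise_pow_char p hp c)

theorem twistedDiff_eq (c : ℕ) (D : Derivation k (MvPolynomial σ k) (MvPolynomial σ k))
    (hD : ∀ i, D (X i) = X i ^ 2) (f : MvPolynomial σ k) :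
    twistedDiff σ k c f = D f + C (1 - c : k) * ((∑ i, X i) * f) := by
  classical
  have sum_apply (d : σ → Derivation k (MvPolynomial σ k) (MvPolynomial σ k)) (g) :
      (∑ i, d i) g = ∑ i, d i g := by
    have h := congr_fun (map_sum (Derivation.coeFnAddMonoidHom (R := k) (A := MvPolynomial σ k)
      (M := MvPolynomial σ k)) d Finset.univ) g
    rwa [Finset.sum_apply] at h
  have hsum : D = ∑ i, (X i ^ 2 : MvPolynomial σ k) • pderiv i := by
    refine derivation_ext fun j => ?_
    rw [hD, sum_apply, Finset.sum_eq_single j]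
    · simp
    · intro i _ hij
      simp [pderiv_X_of_ne hij.symm]
    · simp
  rw [hsum, sum_apply, Finset.sum_mul, Finset.mul_sum,
    ← Finset.sum_add_distrib, twistedDiff, LinearMap.sum_apply]
  exact Finset.sum_congr rfl fun i _ => varRaise_apply c i f

theorem rename_twistedDiff (c : ℕ) (τ : Equiv.Perm σ) (f : MvPolynomial σ k) :
    rename τ (twistedDiff σ k c f) = twistedDiff σ k c (rename τ f) := by
  refine rename_comp_eq_of_monomial τ _ _ (fun m => ?_) f
  rw [twistedDiff, LinearMap.sum_apply, LinearMap.sum_apply, map_sum,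
    ← Equiv.sum_comp τ fun i => varRaise k c i _]
  refine Finset.sum_congr rfl fun i _ => ?_
  simp [rename_monomial, Finsupp.mapDomain_add, Finsupp.mapDomain_apply τ.injective]

theorem rename_homotopy (c : ℕ) (τ : Equiv.Perm σ) (f : MvPolynomial σ k) :
    rename τ (homotopy σ k c f) = homotopy σ k c (rename τ f) := by
  classical
  refine rename_comp_eq_of_monomial τ _ _ (fun m => ?_) f
  have hc : countGE k c (m.mapDomain τ) = countGE k c m := by
    rw [countGE, ← Equiv.sum_comp τ]
    simp [countGE, Finsupp.mapDomain_apply τ.injective]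
  rw [homotopy, Module.End.mul_apply, Module.End.mul_apply, diagOp_monomial, diagOp_monomial,
    LinearMap.sum_apply, LinearMap.sum_apply, map_sum,
    ← Equiv.sum_comp τ fun i => varLower k c i _, hc]
  refine Finset.sum_congr rfl fun i _ => ?_
  have hsub : (m - Finsupp.single i 1).mapDomain τ =
      m.mapDomain τ - Finsupp.single (τ i) 1 := by
    ext t
    obtain ⟨t, rfl⟩ := τ.surjective t
    simp [Finsupp.mapDomain_apply τ.injective, Finsupp.single_apply]
  simp [rename_monomial, hsub, Finsupp.mapDomain_apply τ.injective]

theorem countGE_ne_zero_of_injective (p : ℕ) [CharP k p] (c : ℕ) (hc : c < Fintype.card σ)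
    (hp : Fintype.card σ < p) (m : σ →₀ ℕ) (hm : Function.Injective m) : countGE k c m ≠ 0 := by
  rw [countGE, Finset.sum_boole, Ne, CharP.cast_eq_zero_iff k p]
  have hle : (Finset.univ.filter fun i => c ≤ m i).card ≤ Fintype.card σ := Finset.card_le_univ _
  have hlt : (Finset.univ.filter fun i => ¬ c ≤ m i).card ≤ c := by
    rw [← Finset.card_image_of_injective _ hm]
    refine (Finset.card_le_card fun t => ?_).trans_eq (Finset.card_range c)
    simp only [Finset.mem_image, Finset.mem_filter, Finset.mem_range]
    rintro ⟨i, ⟨-, hi⟩, rfl⟩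
    omega
  have hadd := Finset.card_filter_add_card_filter_not (s := (Finset.univ : Finset σ))
    (fun i => c ≤ m i)
  rw [Finset.card_univ] at hadd
  intro hdvd
  have := Nat.le_of_dvd (by omega) hdvd
  omega

end Operators

section Alternating

variable {σ k : Type*} [Field k]

theorem irreducible_X_sub_X {i j : σ} (hij : i ≠ j) :
    Irreducible (X j - X i : MvPolynomial σ k) := by
  have := irreducible_mul_X_add (1 : MvPolynomial σ k) (-X i) j one_ne_zero (by simp [vars_one])
    (by simp [vars_neg, vars_X, hij.symm]) isRelPrime_one_left
  simpa [sub_eq_add_neg] using this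

variable [DecidableEq σ]

theorem X_sub_X_dvd_sub_aeval (i j : σ) (f : MvPolynomial σ k) :
    (X j - X i : MvPolynomial σ k) ∣ f - aeval (fun t => X (if t = j then i else t)) f := by
  rw [← Ideal.mem_span_singleton, ← Ideal.Quotient.mk_eq_mk_iff_sub_mem]
  let q := Ideal.Quotient.mkₐ k (Ideal.span {(X j - X i : MvPolynomial σ k)})
  have : q = q.comp (aeval (fun t => (X (if t = j then i else t) : MvPolynomial σ k))) := by
    refine algHom_ext fun t => ?_
    by_cases ht : t = j
    · subst ht
      simp only [AlgHom.comp_apply, aeval_X, if_true]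
      exact (Ideal.Quotient.mk_eq_mk_iff_sub_mem _ _).2 (Ideal.subset_span rfl)
    · simp [ht]
  exact DFunLike.congr_fun this f

theorem eq_or_eq_of_X_sub_X_dvd {i j u v : σ} (huv : u ≠ v)
    (h : (X j - X i : MvPolynomial σ k) ∣ X v - X u) :
    (u = i ∧ v = j) ∨ (u = j ∧ v = i) := by
  have h1 := map_dvd (aeval fun t => (X (if t = j then i else t) : MvPolynomial σ k)) h
  simp only [map_sub, aeval_X, if_true] at h1
  have h2 : (X (if i = j then i else i) : MvPolynomial σ k) = X i := by simp
  rw [h2, sub_self, zero_dvd_iff, sub_eq_zero, (X_injective (R := k)).eq_iff] at h1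
  split_ifs at h1 <;> grind

variable [Fintype σ]

/-- The submodule of alternating (sign-equivariant) polynomials. -/
def alternatingSubmodule (σ k : Type*) [Field k] [Fintype σ] [DecidableEq σ] :
    Submodule k (MvPolynomial σ k) where
  carrier := {f | ∀ τ : Equiv.Perm σ, rename τ f = ((Equiv.Perm.sign τ : ℤ) : k) • f}
  add_mem' hf hg τ := by rw [map_add, hf τ, hg τ, smul_add]
  zero_mem' τ := by simp
  smul_mem' r f hf τ := by rw [map_smul, hf τ, smul_comm]

theorem rename_swap_of_mem_alternating {f : MvPolynomial σ k} (hf : f ∈ alternatingSubmodule σ k)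
    {i j : σ} (hij : i ≠ j) : rename (Equiv.swap i j) f = -f := by
  rw [hf (Equiv.swap i j), Equiv.Perm.sign_swap hij]
  simp

theorem injective_of_mem_support_alternating (h2 : (2 : k) ≠ 0) {f : MvPolynomial σ k}
    (hf : f ∈ alternatingSubmodule σ k) {m : σ →₀ ℕ} (hm : m ∈ f.support) :
    Function.Injective m := by
  intro i j hmij
  by_contra hij
  rw [mem_support_iff] at hm
  have h := coeff_rename_mapDomain (Equiv.swap i j) (Equiv.swap i j).injective f m
  have hswap : m.mapDomain (Equiv.swap i j) = m := by
    ext t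
    obtain ⟨t, rfl⟩ := (Equiv.swap i j).surjective t
    rw [Finsupp.mapDomain_apply (Equiv.swap i j).injective]
    by_cases h1 : t = i
    · subst h1; simp [hmij]
    · by_cases h3 : t = j
      · subst h3; simp [hmij]
      · rw [Equiv.swap_apply_of_ne_of_ne h1 h3]
  rw [hswap, rename_swap_of_mem_alternating hf hij, coeff_neg] at h
  apply hm
  have : 2 * coeff m f = 0 := by linear_combination -h
  exact (mul_eq_zero.1 this).resolve_left h2

theorem twistedDiff_mem_alternating (c : ℕ) (f : MvPolynomial σ k)
    (hf : f ∈ alternatingSubmodule σ k) : twistedDiff σ k c f ∈ alternatingSubmodule σ k :=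
  fun τ => by rw [rename_twistedDiff, hf τ, map_smul]

theorem homotopy_mem_alternating (c : ℕ) (f : MvPolynomial σ k)
    (hf : f ∈ alternatingSubmodule σ k) : homotopy σ k c f ∈ alternatingSubmodule σ k :=
  fun τ => by rw [rename_homotopy, hf τ, map_smul]

theorem X_sub_X_dvd_of_mem_alternating (h2 : (2 : k) ≠ 0) {f : MvPolynomial σ k}
    (hf : f ∈ alternatingSubmodule σ k) {i j : σ} (hij : i ≠ j) :
    (X j - X i : MvPolynomial σ k) ∣ f := by
  have h := X_sub_X_dvd_sub_aeval i j f
  have hcomp : (aeval (R := k) fun t => (X (if t = j then i else t) : MvPolynomial σ k)).comp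
      (rename (Equiv.swap i j)) =
        aeval (R := k) fun t => (X (if t = j then i else t) : MvPolynomial σ k) := by
    refine algHom_ext fun t => ?_
    simp only [AlgHom.comp_apply, rename_X, aeval_X]
    by_cases h1 : t = i
    · subst h1; simp
    · by_cases h3 : t = j
      · subst h3; simp
      · rw [Equiv.swap_apply_of_ne_of_ne h1 h3]
  have h0 := DFunLike.congr_fun hcomp f
  rw [AlgHom.comp_apply, rename_swap_of_mem_alternating hf hij, map_neg] at h0
  have h3 : C (2 : k) * aeval (fun t => (X (if t = j then i else t) : MvPolynomial σ k)) f = 0 := by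
    rw [map_ofNat]
    linear_combination -h0
  rw [(mul_eq_zero.1 h3).resolve_left (by simpa using h2), sub_zero] at h
  exact h

end Alternating

section Vandermonde

variable {k : Type*} [Field k] {n : ℕ}

/-- The Vandermonde polynomial. -/
noncomputable def vandermondePoly (n : ℕ) (k : Type*) [Field k] : MvPolynomial (Fin n) k :=
  ∏ i : Fin n, ∏ j ∈ Finset.Ioi i, (X j - X i)

theorem vandermondePoly_eq_det :
    vandermondePoly n k = (Matrix.vandermonde (X : Fin n → MvPolynomial (Fin n) k)).det :=
  (Matrix.det_vandermonde _).symm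

theorem vandermondePoly_ne_zero : vandermondePoly n k ≠ 0 := by
  rw [vandermondePoly_eq_det, Matrix.det_vandermonde_ne_zero_iff]
  exact X_injective

theorem vandermondePoly_mem_alternating :
    vandermondePoly n k ∈ alternatingSubmodule (Fin n) k := by
  intro τ
  rw [vandermondePoly_eq_det, AlgHom.map_det]
  have : (rename τ : MvPolynomial (Fin n) k →ₐ[k] _).mapMatrix (Matrix.vandermonde X) =
      (Matrix.vandermonde X).submatrix τ id := by
    ext1 i j
    simp [Matrix.vandermonde_apply]
  rw [this, Matrix.det_permute, smul_eq_C_mul]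
  simp

theorem vandermondePoly_dvd_of_mem_alternating (h2 : 2 ≤ n → (2 : k) ≠ 0)
    {f : MvPolynomial (Fin n) k} (hf : f ∈ alternatingSubmodule (Fin n) k) :
    vandermondePoly n k ∣ f := by
  rw [vandermondePoly, Finset.prod_sigma']
  refine Finset.prod_dvd_of_isRelPrime ?_ ?_
  · rintro ⟨i, j⟩ hij ⟨u, v⟩ huv hne
    simp only [Finset.coe_sigma, Set.mem_sigma_iff, Finset.coe_univ, Set.mem_univ, true_and,
      Finset.coe_Ioi, Set.mem_Ioi] at hij huv
    rw [Function.onFun, (irreducible_X_sub_X hij.ne).isRelPrime_iff_not_dvd]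
    intro hdvd
    rcases eq_or_eq_of_X_sub_X_dvd huv.ne hdvd with ⟨rfl, rfl⟩ | ⟨rfl, rfl⟩
    · exact hne rfl
    · exact hij.not_gt huv
  · rintro ⟨i, j⟩ hij
    simp only [Finset.mem_sigma, Finset.mem_univ, Finset.mem_Ioi, true_and] at hij
    have hn : 2 ≤ n := by
      have := j.isLt
      have : i.val < j.val := hij
      omega
    exact X_sub_X_dvd_of_mem_alternating (h2 hn) hf hij.ne

theorem vandermondePoly_mul_mem_alternating_iff (f : MvPolynomial (Fin n) k) :
    vandermondePoly n k * f ∈ alternatingSubmodule (Fin n) k ↔ f.IsSymmetric := by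
  refine forall_congr' fun τ => ?_
  rw [map_mul, vandermondePoly_mem_alternating τ, ← smul_mul_assoc]
  refine ⟨fun h => mul_left_cancel₀ ?_ h, fun h => by rw [h]⟩
  refine smul_ne_zero ?_ vandermondePoly_ne_zero
  rcases Int.units_eq_one_or (Equiv.Perm.sign τ) with h | h <;> simp [h]

theorem derivation_prod_of_apply_eq_mul {R A ι : Type*} [CommRing R] [CommRing A] [Algebra R A]
    (D : Derivation R A A) (s : Finset ι) (f u : ι → A) (h : ∀ i ∈ s, D (f i) = u i * f i) :
    D (∏ i ∈ s, f i) = (∑ i ∈ s, u i) * ∏ i ∈ s, f i := by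
  classical
  induction s using Finset.induction_on with
  | empty => simp
  | insert i s hi ih =>
    rw [Finset.prod_insert hi, Finset.sum_insert hi, D.leibniz,
      ih fun j hj => h j (Finset.mem_insert_of_mem hj), h i (Finset.mem_insert_self i s)]
    simp only [smul_eq_mul]
    ring

theorem sum_sum_Ioi_add {A : Type*} [CommRing A] (x : Fin n → A) :
    ∑ i, ∑ j ∈ Finset.Ioi i, (x j + x i) = ((n : A) - 1) * ∑ i, x i := by
  simp only [Finset.sum_add_distrib]
  rw [Finset.sum_comm' (t' := Finset.univ) (s' := fun j => Finset.Iio j) (by simp),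
    ← Finset.sum_add_distrib, Finset.mul_sum]
  refine Finset.sum_congr rfl fun i _ => ?_
  simp only [Finset.sum_const, Fin.card_Ioi, Fin.card_Iio, nsmul_eq_mul]
  rw [← add_mul, ← Nat.cast_add, show (i : ℕ) + (n - 1 - i) = n - 1 by omega,
    Nat.cast_sub (by have := i.isLt; omega), Nat.cast_one]

theorem derivation_vandermondePoly
    (D : Derivation k (MvPolynomial (Fin n) k) (MvPolynomial (Fin n) k))
    (hD : ∀ i, D (X i) = X i ^ 2) :
    D (vandermondePoly n k) = ((n : MvPolynomial (Fin n) k) - 1) * (∑ i, X i) *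
      vandermondePoly n k := by
  rw [← sum_sum_Ioi_add, vandermondePoly]
  refine derivation_prod_of_apply_eq_mul D _ _ _ fun i _ => ?_
  refine derivation_prod_of_apply_eq_mul D _ _ _ fun j _ => ?_
  rw [map_sub, hD, hD]
  ring

end Vandermonde

/-- For `1 ≤ a ≤ n < p`, the rank-one twisted `p`-complex `(Sym_n, D_a)` with
`D_a(f) = ∂(f) + a·e_1·f` is acyclic: for all `1 ≤ s ≤ p-1`, the kernel of `D_a^s`
on symmetric polynomials equals the image of `D_a^{p-s}`. -/
theorem stmt5 (p : ℕ) (hp : p.Prime) (k : Type*) [Field k] [CharP k p]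
    (n a : ℕ) (ha1 : 1 ≤ a) (han : a ≤ n) (hnp : n < p)
    (D : Derivation k (MvPolynomial (Fin n) k) (MvPolynomial (Fin n) k))
    (hD : ∀ i, D (X i) = X i ^ 2)
    (Da : MvPolynomial (Fin n) k → MvPolynomial (Fin n) k)
    (hDa : ∀ f, Da f = D f + (a : MvPolynomial (Fin n) k) * (esymm (Fin n) k 1 * f)) :
    ∀ s : ℕ, 1 ≤ s → s ≤ p - 1 →
      {f | f.IsSymmetric ∧ Da^[s] f = 0} = Da^[p - s] '' {f | f.IsSymmetric} := by
  intro s hs hsp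
  set V := vandermondePoly n k
  set A := alternatingSubmodule (Fin n) k
  set E := twistedDiff (Fin n) k (n - a)
  have hV0 : V ≠ 0 := vandermondePoly_ne_zero
  have h2 : 2 ≤ n → (2 : k) ≠ 0 := fun hn h => by
    have := Nat.le_of_dvd two_pos ((CharP.cast_eq_zero_iff k p 2).1 (by exact_mod_cast h))
    omega
  have hEV : ∀ f, E (V * f) = V * Da f := fun f => by
    have hC : (C (1 - ((n - a : ℕ) : k)) : MvPolynomial (Fin n) k) = 1 - (n - a) := by
      rw [Nat.cast_sub han]
      simp
    rw [twistedDiff_eq _ D hD, hDa, D.leibniz, derivation_vandermondePoly D hD, esymm_one, hC]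
    simp only [smul_eq_mul]
    ring
  have hEV_pow : ∀ (j : ℕ) f, (E ^ j) (V * f) = V * Da^[j] f := fun j => by
    induction j with
    | zero => simp
    | succ j ih =>
      intro f
      rw [pow_succ, Module.End.mul_apply, hEV, ih, Function.iterate_succ_apply]
  have hEA : ∀ f ∈ A, E f ∈ A := twistedDiff_mem_alternating _
  have hEA_pow : ∀ (j : ℕ), ∀ f ∈ A, (E ^ j) f ∈ A := fun j => by
    induction j with
    | zero => simp
    | succ j ih => intro f hf; rw [pow_succ, Module.End.mul_apply]; exact ih _ (hEA f hf)
  have hcomm : ∀ f ∈ A, E (homotopy (Fin n) k (n - a) f) =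
      homotopy (Fin n) k (n - a) (E f) + f := fun f hf => by
    refine twistedDiff_homotopy _ f fun m hm => ?_
    refine countGE_ne_zero_of_injective p _ (by simp; omega) (by simpa using hnp) m ?_
    rcases Nat.lt_or_ge n 2 with hn | hn
    · have : Subsingleton (Fin n) := Fin.subsingleton_iff_le_one.2 (by omega)
      exact Function.injective_of_subsingleton _
    · exact injective_of_mem_support_alternating (h2 hn) hf hm
  ext f
  constructor
  · rintro ⟨hf, hf0⟩
    obtain ⟨u, hu, huf⟩ := exists_pow_apply_eq_of_commutator_eq_one p hp A E _ hEA
      (homotopy_mem_alternating _) hcomm s hs hsp (V * f)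
      ((vandermondePoly_mul_mem_alternating_iff f).2 hf) (by rw [hEV_pow, hf0, mul_zero])
    obtain ⟨g, rfl⟩ := vandermondePoly_dvd_of_mem_alternating h2 hu
    refine ⟨g, (vandermondePoly_mul_mem_alternating_iff g).1 hu, mul_left_cancel₀ hV0 ?_⟩
    rw [← hEV_pow, huf]
  · rintro ⟨g, hg, rfl⟩
    refine ⟨?_, mul_left_cancel₀ hV0 ?_⟩
    · rw [← vandermondePoly_mul_mem_alternating_iff, ← hEV_pow]
      exact hEA_pow _ _ ((vandermondePoly_mul_mem_alternating_iff g).2 hg)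
    · rw [← Function.iterate_add_apply, show s + (p - s) = p by omega, ← hEV_pow,
        twistedDiff_pow_char p hp]
      simp
end

section
/- Let k be a field of characteristic p (p prime), 1 ≤ n ≤ p−1, and n+1 ≤ a ≤ p. Consider the twisted p-complex (Sym_n, D_a) with D_a(f) = ∂(f) + a·e_1·f (coefficient a cast from ℕ into k), and let I_a ⊂ Sym_n be the k-linear span of the monomials e_1^{i_1}⋯e_n^{i_n} with i_1 + ⋯ + i_n > p − a. Then I_a is stable under D_a, and the p-complex (I_a, D_a) is acyclic: for every s with 1 ≤ s ≤ p−1, {f ∈ I_a : D_a^s f = 0} = D_a^{p−s}(I_a). (Equivalently, the quotient map S_n(a) → S_n(a)/I_a is a quasi-isomorphism of p-DG Sym_n-modules, i.e., all cohomology of S_n(a) is carried by the monomials of d-degree at most p−a.) -/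
open MvPolynomial

/-- If `M (r + 1) = [T, M r]` for `r < N`, then `M N` maps the kernel of `T ^ s` into the range
of `T ^ (N + 1 - s)`. -/
theorem mem_range_pow_of_iterated_commutator {k V : Type*} [Field k] [AddCommGroup V] [Module k V]
    (T : Module.End k V) (M : ℕ → Module.End k V) (N : ℕ)
    (hM : ∀ r < N, ∀ v, M (r + 1) v = T (M r v) - M r (T v)) (s : ℕ) (v : V)
    (hv : (T ^ s) v = 0) : ∃ w, (T ^ (N + 1 - s)) w = M N v := by
  induction N generalizing s v with
  | zero =>
    rcases s with _ | s
    · exact ⟨0, by simp_all⟩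
    · exact ⟨M 0 v, by simp⟩
  | succ N ih =>
    rcases s with _ | s
    · exact ⟨0, by simp_all⟩
    · have hM' : ∀ r < N, ∀ v, M (r + 1) v = T (M r v) - M r (T v) := fun r hr => hM r (by omega)
      obtain ⟨w, hw⟩ := ih hM' (s + 1) v hv
      obtain ⟨w', hw'⟩ := ih hM' s (T v) (by rwa [pow_succ] at hv)
      rw [hM N (by omega), ← hw, ← hw']
      rcases Nat.lt_or_ge N s with h | h
      · refine ⟨T w - w', ?_⟩
        rw [show N + 1 + 1 - (s + 1) = 0 by omega, show N + 1 - (s + 1) = 0 by omega,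
          show N + 1 - s = 0 by omega]
        simp
      · refine ⟨w - w', ?_⟩
        rw [show N + 1 + 1 - (s + 1) = N + 1 - s by omega,
          show N + 1 - s = (N + 1 - (s + 1)) + 1 by omega, map_sub]
        conv_lhs => enter [1]; rw [pow_succ']
        rfl

/-- In characteristic `p`, the `p`-th power of a derivation is a derivation. -/
theorem derivation_pow_char_mul {k A : Type*} [Field k] [CommRing A] [Algebra k A] [Nontrivial A]
    (p : ℕ) [Fact p.Prime] [CharP k p] (δ : Derivation k A A) (f g : A) :
    (δ.toLinearMap ^ p) (f * g) =
      f * (δ.toLinearMap ^ p) g + (δ.toLinearMap ^ p) f * g := by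
  set T : Module.End k A := δ.toLinearMap with hT
  have : CharP (Module.End k (Module.End k A)) p :=
    charP_of_injective_algebraMap (algebraMap k (Module.End k (Module.End k A))).injective p
  have key : (LinearMap.mulLeft k T - LinearMap.mulRight k T) ^ p =
      LinearMap.mulLeft k T ^ p - LinearMap.mulRight k T ^ p :=
    sub_pow_char_of_commute (R := Module.End k (Module.End k A)) p
      (LinearMap.commute_mulLeft_right T T)
  have iter : ∀ m, ((LinearMap.mulLeft k T - LinearMap.mulRight k T) ^ m) (LinearMap.mulLeft k f)
      = LinearMap.mulLeft k ((T ^ m) f) := by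
    intro m
    induction m with
    | zero => simp
    | succ m ih =>
      rw [pow_succ', Module.End.mul_apply, ih]
      ext x
      simp [hT, pow_succ', mul_comm]
  have := congrArg (fun F => F (LinearMap.mulLeft k f) g) key
  simp only [iter, LinearMap.sub_apply, LinearMap.pow_mulLeft, LinearMap.pow_mulRight] at this
  simp at this
  linear_combination -this

theorem derivation_pow_char_eq_zero {k σ : Type*} [Field k] (p : ℕ) [Fact p.Prime] [CharP k p]
    (δ : Derivation k (MvPolynomial σ k) (MvPolynomial σ k)) (hδ : ∀ i, δ (X i) = X i ^ 2) :
    δ.toLinearMap ^ p = 0 := by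
  set T : Module.End k (MvPolynomial σ k) := δ.toLinearMap with hT
  have hp : 0 < p := (Fact.out : p.Prime).pos
  have hX : ∀ i m, (T ^ m) (X i) = (m.factorial : MvPolynomial σ k) * X i ^ (m + 1) := by
    intro i m
    induction m with
    | zero => simp
    | succ m ih =>
      rw [pow_succ', Module.End.mul_apply, ih]
      simp only [hT, Derivation.coeFn_coe, Derivation.leibniz, Derivation.map_natCast,
        Derivation.leibniz_pow, hδ, Nat.factorial_succ]
      simp
      ring
  refine LinearMap.ext fun f => ?_
  rw [LinearMap.zero_apply]
  induction f using MvPolynomial.induction_on with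
  | C r =>
    obtain ⟨q, rfl⟩ : ∃ q, p = q + 1 := ⟨p - 1, by omega⟩
    rw [pow_succ, Module.End.mul_apply, hT, Derivation.coeFn_coe, derivation_C, map_zero]
  | add f g hf hg => rw [map_add, hf, hg, add_zero]
  | mul_X f i hf =>
    rw [derivation_pow_char_mul, hf, hX, zero_mul, add_zero,
      (CharP.cast_eq_zero_iff (MvPolynomial σ k) p _).2 (Nat.dvd_factorial hp le_rfl)]
    simp

theorem derivation_monomial_of_sq {k σ : Type*} [Field k] [Fintype σ]
    (δ : Derivation k (MvPolynomial σ k) (MvPolynomial σ k)) (hδ : ∀ i, δ (X i) = X i ^ 2)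
    (m : σ →₀ ℕ) :
    δ (monomial m 1) = ∑ l, (m l : k) • monomial (m + Finsupp.single l 1) 1 := by
  have h : δ = mkDerivation k (fun i => X i ^ 2) := derivation_ext fun i => by simp [hδ]
  rw [h, mkDerivation_monomial, one_smul]
  refine (Finsupp.sum_fintype m _ (by simp)).trans ?_
  refine Finset.sum_congr rfl fun l _ => ?_
  rcases Nat.eq_zero_or_pos (m l) with h0 | h0
  · simp [h0]
  · rw [smul_eq_mul, X_pow_eq_monomial, monomial_mul, smul_monomial]
    congr 2
    · ext j
      by_cases hj : l = j
      · subst hj; simp; omega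
      · simp [hj]

/-- Division by `X i ^ (p - 1 - r)`, scaled by `r!` and truncated to the monomials on which the
quotient has a positive exponent of `X i`. -/
noncomputable def truncatedDivision (k : Type*) {σ : Type*} [Field k] (p : ℕ) (i : σ) (r : ℕ) :
    Module.End k (MvPolynomial σ k) := by
  classical
  exact (basisMonomials σ k).constr k fun m =>
    if p ≤ m i + r then (r.factorial : k) • monomial (m.update i (m i + r + 1 - p)) 1 else 0

open Classical in
theorem truncatedDivision_monomial {k σ : Type*} [Field k] (p : ℕ) (i : σ) (r : ℕ) (m : σ →₀ ℕ) :
    truncatedDivision k p i r (monomial m 1) =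
      if p ≤ m i + r then (r.factorial : k) • monomial (m.update i (m i + r + 1 - p)) 1 else 0 := by
  have := (basisMonomials σ k).constr_basis k (fun m =>
    if p ≤ m i + r then (r.factorial : k) • monomial (m.update i (m i + r + 1 - p)) (1 : k) else 0) m
  rw [coe_basisMonomials] at this
  exact this

theorem truncatedDivision_succ {k σ : Type*} [Field k] [Fintype σ] (p : ℕ) [CharP k p]
    (δ : Derivation k (MvPolynomial σ k) (MvPolynomial σ k)) (hδ : ∀ i, δ (X i) = X i ^ 2)
    (i : σ) (r : ℕ) (v : MvPolynomial σ k) :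
    truncatedDivision k p i (r + 1) v =
      δ (truncatedDivision k p i r v) - truncatedDivision k p i r (δ v) := by
  classical
  suffices h : truncatedDivision k p i (r + 1) =
      δ.toLinearMap * truncatedDivision k p i r - truncatedDivision k p i r * δ.toLinearMap from
    congrArg (fun F => F v) h
  refine (basisMonomials σ k).ext fun m => ?_
  simp only [coe_basisMonomials, LinearMap.sub_apply, Module.End.mul_apply, Derivation.coeFn_coe]
  set c : k := if p ≤ m i + r then (r.factorial : k) else 0 with hc
  have hM : truncatedDivision k p i r (monomial m 1) =
      c • monomial (m.update i (m i + r + 1 - p)) 1 := by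
    rw [truncatedDivision_monomial, hc]; split_ifs <;> simp
  rw [hM, Derivation.map_smul, derivation_monomial_of_sq δ hδ, derivation_monomial_of_sq δ hδ,
    map_sum, Finset.smul_sum, ← Finset.sum_sub_distrib, Finset.sum_eq_single i]
  · have hup : m.update i (m i + r + 1 - p) + Finsupp.single i 1 =
        m.update i (m i + r + 1 - p + 1) := by
      ext j
      by_cases hj : j = i
      · subst hj; simp
      · simp [Finsupp.update_apply, hj]
    have hup' : ∀ t, (m + Finsupp.single i 1).update i t = m.update i t := by
      intro t
      ext j
      by_cases hj : j = i
      · subst hj; simp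
      · simp [Finsupp.update_apply, hj]
    rw [map_smul, truncatedDivision_monomial, truncatedDivision_monomial, hup, hup', hc]
    have hp0 : (p : k) = 0 := CharP.cast_eq_zero k p
    simp only [Finsupp.add_apply, Finsupp.single_eq_same, Finsupp.update_apply, if_true]
    rcases lt_trichotomy (m i + r + 1) p with h | h | h
    · simp [show ¬ p ≤ m i + (r + 1) by omega, show ¬ p ≤ m i + r by omega,
        show ¬ p ≤ m i + 1 + r by omega]
    · have hmi : (m i : k) = - ((r : k) + 1) := by
        have := congrArg (Nat.cast : ℕ → k) h
        push_cast at this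
        linear_combination this + hp0
      simp only [show p ≤ m i + (r + 1) by omega, show ¬ p ≤ m i + r by omega,
        show p ≤ m i + 1 + r by omega, if_true, if_false, zero_mul, zero_smul, zero_sub, hmi,
        smul_smul, ← neg_smul, show m i + 1 + r + 1 - p = m i + (r + 1) + 1 - p by omega]
      congr 1
      rw [Nat.factorial_succ]; push_cast; ring
    · have hmi : ((m i + r + 1 - p : ℕ) : k) = m i + r + 1 := by
        rw [Nat.cast_sub h.le]; push_cast; rw [hp0]; ring
      simp only [show p ≤ m i + (r + 1) by omega, show p ≤ m i + r by omega,
        show p ≤ m i + 1 + r by omega, if_true, hmi, smul_smul, ← sub_smul,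
        show m i + 1 + r + 1 - p = m i + (r + 1) + 1 - p by omega,
        show m i + r + 1 - p + 1 = m i + (r + 1) + 1 - p by omega]
      congr 1
      rw [Nat.factorial_succ]; push_cast; ring
  · intro l _ hl
    have hup : ∀ t, m.update i t + Finsupp.single l 1 = (m + Finsupp.single l 1).update i t := by
      intro t
      ext j
      by_cases hj : j = i
      · subst hj; simp [hl]
      · simp [Finsupp.update_apply, hj]
    rw [map_smul, truncatedDivision_monomial, hc, hup]
    simp only [Finsupp.add_apply, Finsupp.update_apply, hl, if_false,
      Finsupp.single_eq_of_ne (Ne.symm hl), add_zero]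
    split_ifs
    · rw [smul_comm, sub_self]
    · simp
  · simp

/-- The substitution `X i = 0` for `i ∈ S`. -/
noncomputable def zeroVars (k : Type*) {σ : Type*} [Field k] [DecidableEq σ] (S : Finset σ) :
    MvPolynomial σ k →ₐ[k] MvPolynomial σ k :=
  aeval fun l => if l ∈ S then 0 else X l

theorem derivation_zeroVars {k σ : Type*} [Field k] [DecidableEq σ] (S : Finset σ)
    (δ : Derivation k (MvPolynomial σ k) (MvPolynomial σ k)) (hδ : ∀ i, δ (X i) = X i ^ 2)
    (f : MvPolynomial σ k) : δ (zeroVars k S f) = zeroVars k S (δ f) := by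
  induction f using MvPolynomial.induction_on with
  | C r => simp [zeroVars, algebraMap_eq]
  | add f g hf hg => simp only [map_add, hf, hg]
  | mul_X f i hf =>
    have hX : δ (zeroVars k S (X i)) = zeroVars k S (δ (X i)) := by
      by_cases h : i ∈ S <;> simp [zeroVars, hδ, h]
    simp only [map_mul, Derivation.leibniz, map_add, smul_eq_mul, hX, hf]

theorem truncatedDivision_pred {k σ : Type*} [Field k] [DecidableEq σ] (p : ℕ) (hp : 0 < p) (i : σ)
    (v : MvPolynomial σ k) : truncatedDivision k p i (p - 1) v =
      ((p - 1).factorial : k) • (v - zeroVars k {i} v) := by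
  suffices h : truncatedDivision k p i (p - 1) =
      ((p - 1).factorial : k) • (1 - (zeroVars k {i}).toLinearMap) from congrArg (fun F => F v) h
  refine (basisMonomials σ k).ext fun m => ?_
  simp only [coe_basisMonomials, LinearMap.smul_apply, LinearMap.sub_apply, Module.End.one_apply,
    AlgHom.toLinearMap_apply]
  rw [truncatedDivision_monomial, zeroVars, aeval_monomial]
  by_cases h : m i = 0
  · rw [if_neg (by omega)]
    have : (m.prod fun l e => (if l ∈ ({i} : Finset σ) then (0 : MvPolynomial σ k) else X l) ^ e) =
        monomial m 1 := by
      rw [monomial_eq, map_one, one_mul]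
      refine Finsupp.prod_congr fun l hl => ?_
      rw [if_neg]
      rintro hli
      rw [Finset.mem_singleton] at hli
      subst hli
      exact (Finsupp.mem_support_iff.1 hl) h
    rw [this]; simp
  · rw [if_pos (by omega), Finsupp.prod, Finset.prod_eq_zero (i := i) (by simpa using h)
      (by simp [h])]
    rw [show m i + (p - 1) + 1 - p = m i by omega]
    have : m.update i (m i) = m := by ext j; by_cases hj : j = i <;> simp [hj]
    simp [this]

/-- The polynomial ring with differential `X i ↦ X i ^ 2` has cohomology only in degree zero. -/
theorem exists_pow_eq_of_constantCoeff_eq_zero {k σ : Type*} [Field k] [Fintype σ] (p : ℕ)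
    [Fact p.Prime] [CharP k p]
    (δ : Derivation k (MvPolynomial σ k) (MvPolynomial σ k)) (hδ : ∀ i, δ (X i) = X i ^ 2)
    (s : ℕ) (f : MvPolynomial σ k) (hf : constantCoeff f = 0)
    (hs : (δ.toLinearMap ^ s) f = 0) : ∃ g, (δ.toLinearMap ^ (p - s)) g = f := by
  classical
  have hp : 0 < p := (Fact.out : p.Prime).pos
  have hcomm : ∀ (S : Finset σ) (m : ℕ) (g : MvPolynomial σ k),
      (δ.toLinearMap ^ m) (zeroVars k S g) = zeroVars k S ((δ.toLinearMap ^ m) g) := by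
    intro S m g
    induction m with
    | zero => rfl
    | succ m ih =>
      rw [pow_succ', Module.End.mul_apply, ih, Module.End.mul_apply]
      exact derivation_zeroVars S δ hδ _
  have hfact : ((p - 1).factorial : k) ≠ 0 := by
    rw [Ne, CharP.cast_eq_zero_iff k p, (Fact.out : p.Prime).dvd_factorial]
    omega
  have key : ∀ S : Finset σ, f - zeroVars k S f ∈ LinearMap.range (δ.toLinearMap ^ (p - s)) := by
    intro S
    induction S using Finset.induction_on with
    | empty =>
      have : zeroVars k (∅ : Finset σ) f = f := by simp [zeroVars]
      rw [this, sub_self]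
      exact Submodule.zero_mem _
    | insert i S _ ih =>
      have hins : zeroVars k (insert i S) f = zeroVars k {i} (zeroVars k S f) := by
        suffices h : zeroVars k (insert i S) = (zeroVars k {i}).comp (zeroVars k S) from
          congrArg (fun F => F f) h
        refine algHom_ext fun l => ?_
        rw [AlgHom.comp_apply]
        by_cases h1 : l = i <;> by_cases h2 : l ∈ S <;> simp_all [zeroVars]
      obtain ⟨w, hw⟩ := mem_range_pow_of_iterated_commutator δ.toLinearMap
        (truncatedDivision k p i) (p - 1) (fun r _ v => truncatedDivision_succ p δ hδ i r v) s
        (zeroVars k S f) (by rw [hcomm, hs, map_zero])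
      rw [truncatedDivision_pred p hp, ← hins, Nat.sub_add_cancel hp] at hw
      have h2 : zeroVars k S f - zeroVars k (insert i S) f ∈
          LinearMap.range (δ.toLinearMap ^ (p - s)) :=
        (Submodule.smul_mem_iff _ hfact).1 ⟨w, hw⟩
      simpa using Submodule.add_mem _ ih h2
  have huniv : zeroVars k Finset.univ f = 0 := by
    have : zeroVars k (Finset.univ : Finset σ) f = C (constantCoeff f) := by
      simp only [zeroVars, Finset.mem_univ, if_true, aeval_zero', algebraMap_eq]
    rw [this, hf, map_zero]
  simpa [huniv] using key Finset.univ

theorem rename_derivation_of_sq {k σ : Type*} [Field k] (e : Equiv.Perm σ)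
    (δ : Derivation k (MvPolynomial σ k) (MvPolynomial σ k)) (hδ : ∀ i, δ (X i) = X i ^ 2)
    (f : MvPolynomial σ k) : δ (rename e f) = rename e (δ f) := by
  induction f using MvPolynomial.induction_on with
  | C r => simp
  | add f g hf hg => simp only [map_add, hf, hg]
  | mul_X f i hf => simp only [map_mul, Derivation.leibniz, map_add, smul_eq_mul, hf, hδ, rename_X,
      map_pow]

theorem exists_isSymmetric_pow_eq {k σ : Type*} [Field k] [Fintype σ] (p : ℕ)
    [Fact p.Prime] [CharP k p] (hσ : Fintype.card σ < p)
    (δ : Derivation k (MvPolynomial σ k) (MvPolynomial σ k)) (hδ : ∀ i, δ (X i) = X i ^ 2)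
    (s : ℕ) (hsp : s < p) (f : MvPolynomial σ k) (hsymm : f.IsSymmetric)
    (hf : constantCoeff f = 0) (hs : (δ.toLinearMap ^ s) f = 0) :
    ∃ g, g.IsSymmetric ∧ constantCoeff g = 0 ∧ (δ.toLinearMap ^ (p - s)) g = f := by
  classical
  obtain ⟨g, hg⟩ := exists_pow_eq_of_constantCoeff_eq_zero p δ hδ s f hf hs
  have hcomm : ∀ (e : Equiv.Perm σ) (m : ℕ) (g : MvPolynomial σ k),
      (δ.toLinearMap ^ m) (rename e g) = rename e ((δ.toLinearMap ^ m) g) := by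
    intro e m g
    induction m with
    | zero => rfl
    | succ m ih =>
      rw [pow_succ', Module.End.mul_apply, ih, Module.End.mul_apply]
      exact rename_derivation_of_sq e δ hδ _
  have hfact : ((Fintype.card σ).factorial : k) ≠ 0 := by
    rw [Ne, CharP.cast_eq_zero_iff k p, (Fact.out : p.Prime).dvd_factorial]
    omega
  set g₁ : MvPolynomial σ k :=
    ((Fintype.card σ).factorial : k)⁻¹ • ∑ e : Equiv.Perm σ, rename e g with hg₁
  have hg₁s : g₁.IsSymmetric := by
    intro e
    rw [hg₁, map_smul, map_sum]
    congr 1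
    simp only [rename_rename]
    exact Fintype.sum_equiv (Equiv.mulLeft e) _ _ fun e' => rfl
  refine ⟨g₁ - C (constantCoeff g₁), hg₁s.sub (IsSymmetric.C _), by simp, ?_⟩
  have hC : (δ.toLinearMap ^ (p - s)) (C (constantCoeff g₁)) = 0 := by
    obtain ⟨q, hq⟩ : ∃ q, p - s = q + 1 := ⟨p - s - 1, by omega⟩
    rw [hq, pow_succ, Module.End.mul_apply, Derivation.coeFn_coe, derivation_C, map_zero]
  rw [map_sub, hC, sub_zero, hg₁, map_smul, map_sum]
  simp only [hcomm, hg]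
  rw [Finset.sum_congr rfl fun e _ => hsymm e, Finset.sum_const, Finset.card_univ,
    Fintype.card_perm, ← Nat.cast_smul_eq_nsmul k, smul_smul, inv_mul_cancel₀ hfact, one_smul]

theorem derivation_esymm {k : Type*} [Field k] {σ : Type*} [Fintype σ]
    (δ : Derivation k (MvPolynomial σ k) (MvPolynomial σ k)) (hδ : ∀ i, δ (X i) = X i ^ 2)
    (j : ℕ) : δ (esymm σ k j) =
      esymm σ k 1 * esymm σ k j - ((j : k) + 1) • esymm σ k (j + 1) := by
  classical
  have hprod : ∀ S : Finset σ,
      δ (∏ i ∈ S, X i) = (∑ i ∈ S, X i) * ∏ i ∈ S, X i := by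
    intro S
    induction S using Finset.induction_on with
    | empty => simp
    | insert i S hi ih =>
      rw [Finset.prod_insert hi, Finset.sum_insert hi, Derivation.leibniz, ih, hδ]
      simp only [smul_eq_mul]
      ring
  have hcount : ∑ S ∈ Finset.powersetCard j (Finset.univ : Finset σ), ∑ i ∈ Sᶜ,
      (X i * ∏ l ∈ S, X l : MvPolynomial σ k) = ((j : k) + 1) • esymm σ k (j + 1) := by
    have h1 : ∀ T ∈ Finset.powersetCard (j + 1) (Finset.univ : Finset σ),
        ((j : k) + 1) • (∏ l ∈ T, X l : MvPolynomial σ k) = ∑ i ∈ T, ∏ l ∈ T, X l := by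
      intro T hT
      rw [Finset.sum_const, (Finset.mem_powersetCard.1 hT).2, ← Nat.cast_smul_eq_nsmul k]
      push_cast
      rfl
    rw [esymm, Finset.smul_sum, Finset.sum_congr rfl h1, Finset.sum_sigma', Finset.sum_sigma']
    refine Finset.sum_bij' (fun x _ => ⟨insert x.2 x.1, x.2⟩) (fun x _ => ⟨x.1.erase x.2, x.2⟩)
      ?_ ?_ ?_ ?_ ?_
    · rintro ⟨S, i⟩ h
      simp only [Finset.mem_sigma, Finset.mem_powersetCard, Finset.mem_compl] at h ⊢
      simp [Finset.card_insert_of_notMem h.2, h.1.2]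
    · rintro ⟨S, i⟩ h
      simp only [Finset.mem_sigma, Finset.mem_powersetCard] at h
      simp [Finset.card_erase_of_mem h.2, h.1.2]
    · rintro ⟨S, i⟩ h
      simp only [Finset.mem_sigma, Finset.mem_compl] at h
      simp [Finset.erase_insert h.2]
    · rintro ⟨S, i⟩ h
      simp only [Finset.mem_sigma] at h
      simp [Finset.insert_erase h.2]
    · rintro ⟨S, i⟩ h
      simp only [Finset.mem_sigma, Finset.mem_compl] at h
      simp [Finset.prod_insert h.2]
  rw [← hcount, esymm_one, esymm, map_sum, Finset.mul_sum, ← Finset.sum_sub_distrib]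
  refine Finset.sum_congr rfl fun S _ => ?_
  rw [hprod, ← Finset.sum_mul, ← Finset.sum_add_sum_compl S]
  ring

theorem map_pow_of_semiconj {k V W : Type*} [Field k] [AddCommGroup V] [Module k V]
    [AddCommGroup W] [Module k W] (F : V → W) (T : Module.End k V) (U : Module.End k W)
    (h : ∀ v, F (T v) = U (F v)) (m : ℕ) (v : V) : F ((T ^ m) v) = (U ^ m) (F v) := by
  induction m with
  | zero => rfl
  | succ m ih => rw [pow_succ', Module.End.mul_apply, h, ih, pow_succ', Module.End.mul_apply]

/-- The variable standing for the elementary symmetric polynomial of degree `j + 1`. -/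
noncomputable def elemVar (k : Type*) [Field k] (n j : ℕ) : MvPolynomial (Fin n) k :=
  if h : j < n then X ⟨j, h⟩ else 0

/-- The differential on symmetric polynomials, in terms of elementary symmetric polynomials. -/
noncomputable def elemDerivation (k : Type*) [Field k] (n : ℕ) :
    Derivation k (MvPolynomial (Fin n) k) (MvPolynomial (Fin n) k) :=
  mkDerivation k fun j => elemVar k n 0 * X j - ((j : k) + 2) • elemVar k n (j + 1)

/-- The twisted differential `f ↦ ∂ f + a * e₁ * f`, in terms of elementary symmetric
polynomials. -/
noncomputable def elemTwist (k : Type*) [Field k] (n a : ℕ) :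
    Module.End k (MvPolynomial (Fin n) k) :=
  (elemDerivation k n).toLinearMap +
    LinearMap.mulLeft k ((a : MvPolynomial (Fin n) k) * elemVar k n 0)

theorem elemTwist_apply {k : Type*} [Field k] (n a : ℕ) (f : MvPolynomial (Fin n) k) :
    elemTwist k n a f = elemDerivation k n f + a * elemVar k n 0 * f := rfl

/-- Evaluation at the elementary symmetric polynomials. -/
noncomputable def evalEsymm (k : Type*) [Field k] (n : ℕ) :
    MvPolynomial (Fin n) k →ₐ[k] MvPolynomial (Fin n) k :=
  aeval fun i : Fin n => esymm (Fin n) k (i + 1)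

theorem evalEsymm_injective {k : Type*} [Field k] (n : ℕ) :
    Function.Injective (evalEsymm k n) := by
  intro f g h
  apply esymmAlgHom_fin_injective k (le_refl n)
  apply Subtype.ext
  rw [esymmAlgHom_apply, esymmAlgHom_apply]
  exact h

theorem esymm_eq_zero_of_card_lt {k σ : Type*} [Field k] [Fintype σ] {j : ℕ}
    (h : Fintype.card σ < j) : esymm σ k j = 0 := by
  rw [esymm, Finset.powersetCard_eq_empty.2 (by rwa [Finset.card_univ]), Finset.sum_empty]

theorem evalEsymm_elemVar {k : Type*} [Field k] (n j : ℕ) :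
    evalEsymm k n (elemVar k n j) = esymm (Fin n) k (j + 1) := by
  rw [elemVar]
  split_ifs with h
  · simp [evalEsymm]
  · rw [map_zero, esymm_eq_zero_of_card_lt (by simp; omega)]

theorem evalEsymm_elemDerivation {k : Type*} [Field k] {n : ℕ}
    (δ : Derivation k (MvPolynomial (Fin n) k) (MvPolynomial (Fin n) k))
    (hδ : ∀ i, δ (X i) = X i ^ 2) (f : MvPolynomial (Fin n) k) :
    evalEsymm k n (elemDerivation k n f) = δ (evalEsymm k n f) := by
  induction f using MvPolynomial.induction_on with
  | C r => simp [evalEsymm, algebraMap_eq]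
  | add f g hf hg => simp only [map_add, hf, hg]
  | mul_X f i hf =>
    have hX : evalEsymm k n (elemDerivation k n (X i)) = δ (evalEsymm k n (X i)) := by
      have : evalEsymm k n (X i) = esymm (Fin n) k (i + 1) := by simp [evalEsymm]
      rw [elemDerivation, mkDerivation_X, map_sub, map_mul, map_smul, evalEsymm_elemVar,
        evalEsymm_elemVar, this, derivation_esymm δ hδ]
      push_cast
      rw [add_assoc (i : k), one_add_one_eq_two]
    simp only [map_mul, Derivation.leibniz, map_add, smul_eq_mul, hX, hf]

theorem constantCoeff_evalEsymm {k : Type*} [Field k] (n : ℕ) (f : MvPolynomial (Fin n) k) :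
    constantCoeff (evalEsymm k n f) = constantCoeff f := by
  induction f using MvPolynomial.induction_on with
  | C r => simp [evalEsymm, algebraMap_eq]
  | add f g hf hg => simp only [map_add, hf, hg]
  | mul_X f i hf =>
    have : constantCoeff (esymm (Fin n) k (i + 1)) = 0 := by
      rw [esymm, map_sum]
      refine Finset.sum_eq_zero fun S hS => ?_
      have hne : S.Nonempty := Finset.card_pos.1 (by rw [(Finset.mem_powersetCard.1 hS).2]; omega)
      obtain ⟨l, hl⟩ := hne
      rw [map_prod]
      exact Finset.prod_eq_zero hl (constantCoeff_X _ l)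
    rw [map_mul, map_mul, map_mul, evalEsymm, aeval_X, this]
    simp

theorem mem_idealOfVars_iff_constantCoeff {k σ : Type*} [Field k] (f : MvPolynomial σ k) :
    f ∈ idealOfVars σ k ↔ constantCoeff f = 0 := by
  rw [← pow_one (idealOfVars σ k), mem_pow_idealOfVars_iff']
  constructor
  · intro h
    exact h 0 (by simp)
  · intro h x hx
    rw [(Finsupp.degree_eq_zero_iff x).1 (by omega)]
    exact h

theorem mem_pow_idealOfVars_derivation {k σ : Type*} [Field k]
    (δ : Derivation k (MvPolynomial σ k) (MvPolynomial σ k))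
    (hδ : ∀ i, δ (X i) ∈ idealOfVars σ k) (m : ℕ) (f : MvPolynomial σ k)
    (hf : f ∈ idealOfVars σ k ^ m) : δ f ∈ idealOfVars σ k ^ m := by
  have h1 : ∀ g ∈ idealOfVars σ k, δ g ∈ idealOfVars σ k := by
    intro g hg
    induction hg using Submodule.span_induction with
    | mem x hx =>
      obtain ⟨i, rfl⟩ := hx
      exact hδ i
    | zero => simp
    | add x y _ _ hx hy => rw [map_add]; exact Ideal.add_mem _ hx hy
    | smul c x hx hy =>
      rw [smul_eq_mul, Derivation.leibniz, smul_eq_mul, smul_eq_mul]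
      exact Ideal.add_mem _ (Ideal.mul_mem_left _ _ hy) (Ideal.mul_mem_right _ _ hx)
  induction m generalizing f with
  | zero => simp
  | succ m ih =>
    rw [pow_succ] at hf ⊢
    induction hf using Submodule.mul_induction_on' with
    | mem_mul_mem x hx y hy =>
      rw [Derivation.leibniz, smul_eq_mul, smul_eq_mul, mul_comm y]
      exact Ideal.add_mem _ (Ideal.mul_mem_mul hx (h1 y hy)) (Ideal.mul_mem_mul (ih x hx) hy)
    | add x _ y _ hx hy => rw [map_add]; exact Ideal.add_mem _ hx hy

theorem elemVar_mem_idealOfVars {k : Type*} [Field k] (n j : ℕ) :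
    elemVar k n j ∈ idealOfVars (Fin n) k := by
  rw [elemVar]
  split_ifs
  · exact Ideal.subset_span ⟨_, rfl⟩
  · exact Ideal.zero_mem _

theorem elemTwist_mem {k : Type*} [Field k] {n : ℕ} (a m : ℕ) (f : MvPolynomial (Fin n) k)
    (hf : f ∈ idealOfVars (Fin n) k ^ m) :
    elemTwist k n a f ∈ idealOfVars (Fin n) k ^ m := by
  rw [elemTwist_apply]
  refine Ideal.add_mem _ (mem_pow_idealOfVars_derivation _ (fun i => ?_) m f hf)
    (Ideal.mul_mem_left _ _ hf)
  rw [elemDerivation, mkDerivation_X]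
  exact Ideal.sub_mem _ (Ideal.mul_mem_right _ _ (elemVar_mem_idealOfVars n 0))
    (Submodule.smul_of_tower_mem _ _ (elemVar_mem_idealOfVars n _))

/-- Acyclicity of the power `p - a + 1` of the ideal of variables under `elemTwist k n a`. -/
def ElemAcyclic (k : Type*) [Field k] (p n a : ℕ) : Prop :=
  ∀ s, 1 ≤ s → s < p → ∀ f ∈ idealOfVars (Fin n) k ^ (p - a + 1), (elemTwist k n a ^ s) f = 0 →
    ∃ g ∈ idealOfVars (Fin n) k ^ (p - a + 1), (elemTwist k n a ^ (p - s)) g = f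

theorem elemAcyclic_self (k : Type*) [Field k] (p : ℕ) [Fact p.Prime] [CharP k p] (n : ℕ)
    (hn : n < p) : ElemAcyclic k p n p := by
  intro s _ hsp f hf hs
  rw [Nat.sub_self, zero_add, pow_one] at hf ⊢
  set δ : Derivation k (MvPolynomial (Fin n) k) (MvPolynomial (Fin n) k) :=
    mkDerivation k fun i => X i ^ 2
  have hδ : ∀ i, δ (X i) = X i ^ 2 := fun i => mkDerivation_X _ _ _
  have hconj : ∀ m v, evalEsymm k n ((elemTwist k n p ^ m) v) =
      (δ.toLinearMap ^ m) (evalEsymm k n v) := by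
    refine map_pow_of_semiconj _ _ _ fun v => ?_
    rw [elemTwist_apply, CharP.cast_eq_zero, zero_mul, zero_mul, add_zero]
    exact evalEsymm_elemDerivation δ hδ v
  obtain ⟨g, hgs, hg0, hg⟩ := exists_isSymmetric_pow_eq p (by simpa using hn) δ hδ s hsp
    (evalEsymm k n f) (by
      have := (esymmAlgHom (Fin n) k n f).2
      rwa [esymmAlgHom_apply] at this)
    (by rwa [constantCoeff_evalEsymm, ← mem_idealOfVars_iff_constantCoeff])
    (by rw [← hconj, hs, map_zero])
  obtain ⟨q, hq⟩ := esymmAlgHom_fin_surjective k (le_refl n) ⟨g, hgs⟩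
  have hq' : evalEsymm k n q = g := by
    have := congrArg Subtype.val hq
    rwa [esymmAlgHom_apply] at this
  refine ⟨q, ?_, evalEsymm_injective n ?_⟩
  · rwa [mem_idealOfVars_iff_constantCoeff, ← constantCoeff_evalEsymm, hq']
  · rw [hconj, hq', hg]

/-- The substitution of zero for the last variable. -/
noncomputable def killLast (k : Type*) [Field k] (n : ℕ) :
    MvPolynomial (Fin (n + 1)) k →ₐ[k] MvPolynomial (Fin n) k :=
  aeval (Fin.lastCases 0 X)

theorem killLast_elemVar {k : Type*} [Field k] (n j : ℕ) :
    killLast k n (elemVar k (n + 1) j) = elemVar k n j := by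
  rw [elemVar, elemVar]
  rcases lt_trichotomy j n with h | h | h
  · rw [dif_pos h, dif_pos (by omega), killLast, aeval_X]
    exact Fin.lastCases_castSucc (⟨j, h⟩ : Fin n)
  · subst h
    rw [dif_neg (lt_irrefl j), dif_pos (Nat.lt_succ_self j), killLast, aeval_X]
    exact Fin.lastCases_last
  · rw [dif_neg (show ¬ j < n + 1 by omega), dif_neg (show ¬ j < n by omega), map_zero]

theorem elemDerivation_elemVar {k : Type*} [Field k] (n j : ℕ) :
    elemDerivation k n (elemVar k n j) =
      elemVar k n 0 * elemVar k n j - ((j : k) + 2) • elemVar k n (j + 1) := by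
  by_cases h : j < n
  · have : elemVar k n j = X ⟨j, h⟩ := dif_pos h
    rw [this, elemDerivation, mkDerivation_X]
  · simp [elemVar, h, show ¬ j + 1 < n by omega]

theorem killLast_elemTwist {k : Type*} [Field k] (n a : ℕ) (f : MvPolynomial (Fin (n + 1)) k) :
    killLast k n (elemTwist k (n + 1) a f) = elemTwist k n a (killLast k n f) := by
  have key : killLast k n (elemDerivation k (n + 1) f) =
      elemDerivation k n (killLast k n f) := by
    induction f using MvPolynomial.induction_on with
    | C r => simp [killLast, algebraMap_eq]
    | add f g hf hg => simp only [map_add, hf, hg]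
    | mul_X f i hf =>
      have hX : killLast k n (elemDerivation k (n + 1) (X i)) =
          elemDerivation k n (killLast k n (X i)) := by
        have hi : (X i : MvPolynomial (Fin (n + 1)) k) = elemVar k (n + 1) i := by
          rw [elemVar, dif_pos i.2]
        rw [hi, killLast_elemVar, elemDerivation_elemVar, elemDerivation_elemVar]
        simp only [map_sub, map_mul, map_smul, killLast_elemVar]
      simp only [map_mul, Derivation.leibniz, map_add, smul_eq_mul, hX, hf]
  simp only [elemTwist_apply, map_add, key, map_mul, map_natCast, killLast_elemVar]

theorem elemTwist_X_last_mul {k : Type*} [Field k] (n a : ℕ) (f : MvPolynomial (Fin (n + 1)) k) :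
    elemTwist k (n + 1) a (X (Fin.last n) * f) =
      X (Fin.last n) * elemTwist k (n + 1) (a + 1) f := by
  have hlast : (X (Fin.last n) : MvPolynomial (Fin (n + 1)) k) = elemVar k (n + 1) n := by
    rw [elemVar, dif_pos (Nat.lt_succ_self n)]
    rfl
  have h0 : elemVar k (n + 1) (n + 1) = 0 := dif_neg (lt_irrefl _)
  rw [elemTwist_apply, elemTwist_apply, hlast, Derivation.leibniz, elemDerivation_elemVar, h0]
  simp only [smul_eq_mul, smul_zero]
  push_cast
  ring

theorem exists_killLast_eq {k : Type*} [Field k] (n m : ℕ) (g : MvPolynomial (Fin n) k)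
    (hg : g ∈ idealOfVars (Fin n) k ^ m) :
    ∃ h ∈ idealOfVars (Fin (n + 1)) k ^ m, killLast k n h = g := by
  refine ⟨rename Fin.castSucc g, ?_, ?_⟩
  · have hle : (idealOfVars (Fin n) k).map (rename (R := k) (Fin.castSucc (n := n))) ≤
        idealOfVars (Fin (n + 1)) k := by
      rw [idealOfVars, Ideal.map_span, Ideal.span_le]
      rintro _ ⟨_, ⟨i, rfl⟩, rfl⟩
      rw [rename_X]
      exact Ideal.subset_span ⟨_, rfl⟩
    have := Ideal.mem_map_of_mem (rename (R := k) (Fin.castSucc (n := n))) hg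
    rw [Ideal.map_pow] at this
    exact Ideal.pow_right_mono hle m this
  · rw [killLast, aeval_rename]
    have : (Fin.lastCases (motive := fun _ => MvPolynomial (Fin n) k) 0 X) ∘ Fin.castSucc = X := by
      funext i
      exact Fin.lastCases_castSucc i
    rw [this, aeval_X_left, AlgHom.id_apply]

theorem exists_X_last_mul_eq {k : Type*} [Field k] (n m : ℕ) (f : MvPolynomial (Fin (n + 1)) k)
    (hf : f ∈ idealOfVars (Fin (n + 1)) k ^ (m + 1)) (h0 : killLast k n f = 0) :
    ∃ h ∈ idealOfVars (Fin (n + 1)) k ^ m, X (Fin.last n) * h = f := by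
  have hdvd : X (Fin.last n) ∣ f := by
    rw [← Ideal.mem_span_singleton]
    have : f - rename Fin.castSucc (killLast k n f) ∈ Ideal.span {X (Fin.last n)} := by
      clear h0 hf
      rw [← Ideal.Quotient.mk_eq_mk_iff_sub_mem]
      induction f using MvPolynomial.induction_on with
      | C r => simp [killLast, algebraMap_eq]
      | add f g hf hg => simp only [map_add, hf, hg]
      | mul_X f i hf =>
        have hX : Ideal.Quotient.mk (Ideal.span {X (Fin.last n)}) (X i) =
            Ideal.Quotient.mk (Ideal.span {X (Fin.last n)})
              (rename Fin.castSucc (killLast k n (X i))) := by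
          induction i using Fin.lastCases with
          | last => simp [killLast]
          | cast i => simp [killLast]
        simp only [map_mul, hX, hf]
    simpa [h0] using this
  obtain ⟨h, rfl⟩ := hdvd
  refine ⟨h, ?_, rfl⟩
  rw [mem_pow_idealOfVars_iff'] at hf ⊢
  intro x hx
  have := hf (Finsupp.single (Fin.last n) 1 + x) (by
    rw [map_add, Finsupp.degree_single]; omega)
  rwa [coeff_X_mul] at this

theorem elemTwist_pow_char {k : Type*} [Field k] (p : ℕ) [Fact p.Prime] [CharP k p] (n a : ℕ) :
    elemTwist k (n + 1) a ^ p = 0 := by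
  refine LinearMap.ext fun f => ?_
  rw [LinearMap.zero_apply]
  induction a generalizing f with
  | zero =>
    set δ : Derivation k (MvPolynomial (Fin (n + 1)) k) (MvPolynomial (Fin (n + 1)) k) :=
      mkDerivation k fun i => X i ^ 2
    have hδ : ∀ i, δ (X i) = X i ^ 2 := fun i => mkDerivation_X _ _ _
    apply evalEsymm_injective
    rw [map_pow_of_semiconj (evalEsymm k (n + 1)) _ δ.toLinearMap,
      derivation_pow_char_eq_zero p δ hδ, LinearMap.zero_apply, map_zero]
    intro v
    rw [elemTwist_apply, Nat.cast_zero, zero_mul, zero_mul, add_zero]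
    exact evalEsymm_elemDerivation δ hδ v
  | succ a ih =>
    have hX := map_pow_of_semiconj (fun h => X (Fin.last n) * h) _ _
      (fun v => (elemTwist_X_last_mul (k := k) n a v).symm) p f
    rw [ih] at hX
    exact (mul_eq_zero.1 hX).resolve_left (X_ne_zero _)

theorem elemAcyclic_of_succ {k : Type*} [Field k] (p : ℕ) [Fact p.Prime] [CharP k p] (n a : ℕ)
    (ha : a + 1 ≤ p)
    (h1 : ElemAcyclic k p (n + 1) (a + 1)) (h2 : ElemAcyclic k p n a) :
    ElemAcyclic k p (n + 1) a := by
  intro s hs hsp f hf hfs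
  have hm : p - a = p - (a + 1) + 1 := by omega
  have hπ := map_pow_of_semiconj (killLast k n) _ _ (killLast_elemTwist n a)
  have hX := map_pow_of_semiconj (fun h => X (Fin.last n) * h) _ _
    (fun v => (elemTwist_X_last_mul (k := k) n a v).symm)
  have hpow : ∀ m, ∀ v ∈ idealOfVars (Fin (n + 1)) k ^ (p - a + 1),
      (elemTwist k (n + 1) a ^ m) v ∈ idealOfVars (Fin (n + 1)) k ^ (p - a + 1) := by
    intro m v hv
    induction m with
    | zero => exact hv
    | succ m ih => rw [pow_succ' _ m, Module.End.mul_apply]; exact elemTwist_mem _ _ _ ih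
  have hle : (idealOfVars (Fin (n + 1)) k).map (killLast k n) ≤ idealOfVars (Fin n) k := by
    rw [idealOfVars, Ideal.map_span, Ideal.span_le]
    rintro _ ⟨_, ⟨i, rfl⟩, rfl⟩
    have hi : (X i : MvPolynomial (Fin (n + 1)) k) = elemVar k (n + 1) i := by
      rw [elemVar, dif_pos i.2]
    rw [hi, killLast_elemVar]
    exact elemVar_mem_idealOfVars n i
  have hfbar : killLast k n f ∈ idealOfVars (Fin n) k ^ (p - a + 1) := by
    have := Ideal.mem_map_of_mem (killLast k n) hf
    rw [Ideal.map_pow] at this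
    exact Ideal.pow_right_mono hle _ this
  obtain ⟨g', hg', hg'f⟩ := h2 s hs hsp _ hfbar (by rw [← hπ, hfs, map_zero])
  obtain ⟨g, hg, rfl⟩ := exists_killLast_eq n _ g' hg'
  obtain ⟨h, hh, hhf⟩ := exists_X_last_mul_eq n (p - a)
    (f - (elemTwist k (n + 1) a ^ (p - s)) g) (Ideal.sub_mem _ hf (hpow _ _ hg))
    (by rw [map_sub, hπ, hg'f, sub_self])
  have hXne : (X (Fin.last n) : MvPolynomial (Fin (n + 1)) k) ≠ 0 := X_ne_zero _
  obtain ⟨h', hh', hh's⟩ := h1 s hs hsp h (by rwa [← hm]) (by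
    refine (mul_eq_zero.1 ?_).resolve_left hXne
    rw [hX, hhf, map_sub, hfs, ← Module.End.mul_apply, ← pow_add,
      Nat.add_sub_cancel' hsp.le, elemTwist_pow_char, LinearMap.zero_apply, sub_zero])
  rw [← hm] at hh'
  refine ⟨g + X (Fin.last n) * h', Ideal.add_mem _ hg ?_, ?_⟩
  · rw [pow_succ']
    exact Ideal.mul_mem_mul (Ideal.subset_span ⟨_, rfl⟩) hh'
  · rw [map_add, ← hX, hh's, hhf, add_sub_cancel]

theorem elemAcyclic_zero (k : Type*) [Field k] (p a : ℕ) : ElemAcyclic k p 0 a := by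
  intro s _ _ f hf _
  have h0 : idealOfVars (Fin 0) k = ⊥ := by simp [idealOfVars]
  rw [h0, pow_succ, Ideal.mul_bot, Ideal.mem_bot] at hf
  exact ⟨0, Ideal.zero_mem _, by rw [map_zero, hf]⟩

theorem elemAcyclic {k : Type*} [Field k] (p : ℕ) [Fact p.Prime] [CharP k p] (n a : ℕ)
    (hna : n + 1 ≤ a) (hap : a ≤ p) : ElemAcyclic k p n a := by
  induction n generalizing a with
  | zero => exact elemAcyclic_zero k p a
  | succ n ih =>
    induction hap using Nat.decreasingInduction with
    | self => exact elemAcyclic_self k p (n + 1) (by omega)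
    | of_succ b hb ihb =>
      exact elemAcyclic_of_succ p n b hb (ihb (by omega)) (ih b (by omega) (by omega))

theorem map_evalEsymm_pow_idealOfVars (k : Type*) [Field k] (n m : ℕ) :
    ((idealOfVars (Fin n) k ^ (m + 1)).restrictScalars k).map (evalEsymm k n).toLinearMap =
      Submodule.span k {f | ∃ i : Fin n → ℕ, m < ∑ j, i j ∧
        f = ∏ j : Fin n, esymm (Fin n) k ((j : ℕ) + 1) ^ i j} := by
  have hmon : ∀ (x : Fin n →₀ ℕ) (c : k), evalEsymm k n (monomial x c) =
      c • ∏ j : Fin n, esymm (Fin n) k ((j : ℕ) + 1) ^ x j := by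
    intro x c
    rw [evalEsymm, aeval_monomial, Finsupp.prod_fintype _ _ (by simp), Algebra.smul_def]
  apply le_antisymm
  · rintro _ ⟨q, hq, rfl⟩
    rw [AlgHom.toLinearMap_apply, q.as_sum, map_sum]
    refine Submodule.sum_mem _ fun x hx => ?_
    have hdeg := (mem_pow_idealOfVars_iff (m + 1) q).1 hq x hx
    rw [hmon]
    refine Submodule.smul_mem _ _ (Submodule.subset_span ⟨x, ?_, rfl⟩)
    rwa [Finsupp.degree_eq_sum, Nat.succ_le_iff] at hdeg
  · rw [Submodule.span_le]
    rintro _ ⟨i, hi, rfl⟩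
    refine ⟨monomial (Finsupp.equivFunOnFinite.symm i) 1, ?_, ?_⟩
    · refine (monomial_mem_pow_idealOfVars_iff _ _ one_ne_zero).2 ?_
      rw [Finsupp.degree_eq_sum]
      exact hi
    · rw [AlgHom.toLinearMap_apply, hmon, one_smul]
      rfl

/-- For `1 ≤ n ≤ p-1` and `n+1 ≤ a ≤ p`, the span `I_a` of the symmetric monomials
`e_1^{i_1} ⋯ e_n^{i_n}` of d-degree `> p - a` is stable under the twisted differential
`D_a(f) = ∂(f) + a·e_1·f`, and `(I_a, D_a)` is an acyclic `p`-complex. -/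
theorem stmt6 (p : ℕ) (hp : p.Prime) (k : Type*) [Field k] [CharP k p]
    (n a : ℕ) (hn1 : 1 ≤ n) (hnp : n ≤ p - 1) (hna : n + 1 ≤ a) (hap : a ≤ p)
    (D : Derivation k (MvPolynomial (Fin n) k) (MvPolynomial (Fin n) k))
    (hD : ∀ i, D (X i) = X i ^ 2)
    (Da : MvPolynomial (Fin n) k → MvPolynomial (Fin n) k)
    (hDa : ∀ f, Da f = D f + (a : MvPolynomial (Fin n) k) * (esymm (Fin n) k 1 * f))
    (Ia : Submodule k (MvPolynomial (Fin n) k))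
    (hIa : Ia = Submodule.span k {f | ∃ i : Fin n → ℕ, p - a < ∑ j, i j ∧
        f = ∏ j : Fin n, esymm (Fin n) k ((j : ℕ) + 1) ^ i j}) :
    (∀ f ∈ Ia, Da f ∈ Ia) ∧
    ∀ s : ℕ, 1 ≤ s → s ≤ p - 1 →
      {f | f ∈ Ia ∧ Da^[s] f = 0} = Da^[p - s] '' (Ia : Set (MvPolynomial (Fin n) k)) := by
  have : Fact p.Prime := ⟨hp⟩
  rw [← map_evalEsymm_pow_idealOfVars] at hIa
  have hconj : ∀ q, evalEsymm k n (elemTwist k n a q) = Da (evalEsymm k n q) := by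
    intro q
    rw [hDa, elemTwist_apply, map_add, map_mul, map_mul, map_natCast, evalEsymm_elemVar,
      evalEsymm_elemDerivation D hD, mul_assoc]
  have hiter : ∀ m q, evalEsymm k n ((elemTwist k n a ^ m) q) = Da^[m] (evalEsymm k n q) := by
    intro m q
    rw [Module.End.pow_apply]
    exact (Function.Semiconj.iterate_right hconj m) q
  have hstable : ∀ f ∈ Ia, Da f ∈ Ia := by
    subst hIa
    rintro _ ⟨q, hq, rfl⟩
    exact ⟨elemTwist k n a q, elemTwist_mem a _ q hq, hconj q⟩
  have hstable' : ∀ m, ∀ f ∈ Ia, Da^[m] f ∈ Ia := by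
    intro m f hf
    induction m with
    | zero => exact hf
    | succ m ih => rw [Function.iterate_succ_apply']; exact hstable _ ih
  refine ⟨hstable, fun s hs hsp => Set.Subset.antisymm ?_ ?_⟩
  · rintro f ⟨hf, hfs⟩
    rw [hIa] at hf
    obtain ⟨q, hq, rfl⟩ := hf
    obtain ⟨g, hg, rfl⟩ := elemAcyclic p n a hna hap s hs (by omega) q hq
      (evalEsymm_injective n (by rw [hiter, map_zero]; exact hfs))
    refine ⟨evalEsymm k n g, ?_, (hiter _ _).symm⟩
    rw [hIa]
    exact ⟨g, hg, rfl⟩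
  · rintro _ ⟨f, hf, rfl⟩
    refine ⟨hstable' _ _ hf, ?_⟩
    rw [hIa] at hf
    obtain ⟨q, hq, rfl⟩ := hf
    obtain ⟨n, rfl⟩ : ∃ n', n = n' + 1 := ⟨n - 1, by omega⟩
    rw [← Function.iterate_add_apply, Nat.add_sub_cancel' (by omega), AlgHom.toLinearMap_apply,
      ← hiter, elemTwist_pow_char, LinearMap.zero_apply, map_zero]
end

section
/- Let k be a field of characteristic p (p prime) and work in p+1 variables, i.e., in k[x_0,…,x_p]. Then for all natural numbers r ≥ 1 and s ≥ 0 one has ∂(e_p^r·e_{p+1}^s) = (r+s)·e_1·e_p^r·e_{p+1}^s − (p+1)·r·e_p^{r−1}·e_{p+1}^{s+1}, all numerical coefficients being natural-number casts into k (so that (p+1)·r = r in characteristic p). -/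
open MvPolynomial

section

variable {R : Type*} [CommRing R]

theorem Derivation.map_prod_X_of_map_X_eq_sq {σ : Type*}
    (D : Derivation R (MvPolynomial σ R) (MvPolynomial σ R))
    (hD : ∀ i, D (X i) = X i ^ 2) (t : Finset σ) :
    D (∏ i ∈ t, X i) = (∑ i ∈ t, X i) * ∏ i ∈ t, X i := by
  classical
  induction t using Finset.induction_on with
  | empty => simp
  | insert a t ha ih =>
    rw [Finset.prod_insert ha, Finset.sum_insert ha, Derivation.leibniz, ih, hD,
      smul_eq_mul, smul_eq_mul]
    ring

theorem MvPolynomial.esymm_fin_succ_top (n : ℕ) :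
    esymm (Fin (n + 1)) R (n + 1) = ∏ i, X i := by
  have h : Finset.powersetCard (n + 1) (Finset.univ : Finset (Fin (n + 1))) =
      {Finset.univ} := by
    simpa using Finset.powersetCard_self (Finset.univ : Finset (Fin (n + 1)))
  rw [esymm, h, Finset.sum_singleton]

theorem MvPolynomial.esymm_fin_succ_eq_sum_prod_erase (n : ℕ) :
    esymm (Fin (n + 1)) R n = ∑ i, ∏ j ∈ Finset.univ.erase i, X j := by
  rw [esymm]
  symm
  refine Finset.sum_bij (fun i _ => Finset.univ.erase i) ?_ ?_ ?_ fun _ _ => rfl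
  · intro i _
    simp [Finset.mem_powersetCard]
  · intro i _ j _ h
    exact (Finset.erase_inj _ (Finset.mem_univ i)).1 h
  · intro t ht
    have hc : tᶜ.card = 1 := by
      rw [Finset.card_compl, (Finset.mem_powersetCard.1 ht).2, Fintype.card_fin]
      omega
    obtain ⟨i, hi⟩ := Finset.card_eq_one.1 hc
    refine ⟨i, Finset.mem_univ i, ?_⟩
    rw [← compl_compl t, hi, Finset.compl_singleton]

theorem Derivation.map_esymm_fin_succ_top {n : ℕ}
    (D : Derivation R (MvPolynomial (Fin (n + 1)) R) (MvPolynomial (Fin (n + 1)) R))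
    (hD : ∀ i, D (X i) = X i ^ 2) :
    D (esymm (Fin (n + 1)) R (n + 1)) =
      esymm (Fin (n + 1)) R 1 * esymm (Fin (n + 1)) R (n + 1) := by
  rw [esymm_fin_succ_top, esymm_one, D.map_prod_X_of_map_X_eq_sq hD]

theorem Derivation.map_esymm_fin_succ {n : ℕ}
    (D : Derivation R (MvPolynomial (Fin (n + 1)) R) (MvPolynomial (Fin (n + 1)) R))
    (hD : ∀ i, D (X i) = X i ^ 2) :
    D (esymm (Fin (n + 1)) R n) = esymm (Fin (n + 1)) R 1 * esymm (Fin (n + 1)) R n -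
      (n + 1 : ℕ) * esymm (Fin (n + 1)) R (n + 1) := by
  have h (i : Fin (n + 1)) : D (∏ j ∈ Finset.univ.erase i, X j) =
      (∑ j, X j) * ∏ j ∈ Finset.univ.erase i, X j - ∏ j, X j := by
    rw [D.map_prod_X_of_map_X_eq_sq hD, ← Finset.add_sum_erase _ _ (Finset.mem_univ i),
      ← Finset.mul_prod_erase Finset.univ X (Finset.mem_univ i)]
    ring
  rw [esymm_fin_succ_eq_sum_prod_erase, esymm_fin_succ_top, esymm_one, map_sum,
    Finset.sum_congr rfl fun i _ => h i, Finset.sum_sub_distrib, ← Finset.mul_sum]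
  simp

end

/-- In `p+1` variables: for `r ≥ 1` and `s ≥ 0`,
`∂(e_p^r · e_{p+1}^s) = (r+s)·e_1·e_p^r·e_{p+1}^s − (p+1)·r·e_p^{r−1}·e_{p+1}^{s+1}`. -/
theorem stmt8 (p : ℕ) (hp : p.Prime) (k : Type*) [Field k] [CharP k p]
    (D : Derivation k (MvPolynomial (Fin (p + 1)) k) (MvPolynomial (Fin (p + 1)) k))
    (hD : ∀ i, D (X i) = X i ^ 2)
    (r s : ℕ) (hr : 1 ≤ r) :
    D (esymm (Fin (p + 1)) k p ^ r * esymm (Fin (p + 1)) k (p + 1) ^ s) =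
      ((r + s : ℕ) : MvPolynomial (Fin (p + 1)) k) * esymm (Fin (p + 1)) k 1 *
          (esymm (Fin (p + 1)) k p ^ r * esymm (Fin (p + 1)) k (p + 1) ^ s)
        - (((p + 1) * r : ℕ) : MvPolynomial (Fin (p + 1)) k) *
          (esymm (Fin (p + 1)) k p ^ (r - 1) * esymm (Fin (p + 1)) k (p + 1) ^ (s + 1)) := by
  obtain ⟨r, rfl⟩ := Nat.exists_eq_add_of_le' hr
  rw [Derivation.leibniz, Derivation.leibniz_pow, Derivation.leibniz_pow,
    D.map_esymm_fin_succ_top hD, D.map_esymm_fin_succ hD]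
  simp only [smul_eq_mul, nsmul_eq_mul, Nat.add_sub_cancel]
  cases s with
  | zero => push_cast; ring
  | succ s => simp only [Nat.add_sub_cancel]; push_cast; ring
end
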